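/- For every integer r ≥ 2, all positive integers h, b₁, b₂, and every ε > 0, there exist an increasing function m : ℕ → ℕ and a positive integer ñ, depending only on r, h, b₁, b₂ and ε (and not on Ω), such that for every (b₁,b₂)-colored 𝔯-partite graph G on Ω one has E_n E_φ [reg_h(G/φ)] ≤ ε, where n is chosen uniformly at random from {0, 1, …, ñ−1} and φ ∈ Φ(m(n)) is a random partitionwise map. -/

import Mathlib

open Finset
open scoped BigOperators Classical

/-! ## Framework: colored partite graphs, complexes, partitionwise maps,
regularization, relative densities and regularity (Ishigami's setting). -/

/-- Partitionwise maps `Φ(h)`: `h` sample vertices in each of the `r` parts. -/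
abbrev PMap {r : ℕ} (Ω : Fin r → Type) (h : ℕ) : Type := ∀ i : Fin r, Fin h → Ω i

/-- The product weight of a partitionwise map (each sample independent). -/
noncomputable def pmapWeight {r : ℕ} (Ω : Fin r → Type) [∀ i, Fintype (Ω i)]
    (w : ∀ i, Ω i → ℝ) {h : ℕ} (φ : PMap Ω h) : ℝ :=
  ∏ i : Fin r, ∏ a : Fin h, w i (φ i a)

/-- Expectation over a random partitionwise map in `Φ(h)`. -/
noncomputable def EPhi {r : ℕ} (Ω : Fin r → Type) [∀ i, Fintype (Ω i)]
    (w : ∀ i, Ω i → ℝ) (h : ℕ) (f : PMap Ω h → ℝ) : ℝ :=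
  ∑ φ : PMap Ω h, pmapWeight Ω w φ * f φ

/-- Conditional expectation over a random partitionwise map in `Φ(h)`. -/
noncomputable def EPhiCond {r : ℕ} (Ω : Fin r → Type) [∀ i, Fintype (Ω i)]
    (w : ∀ i, Ω i → ℝ) (h : ℕ) (A : PMap Ω h → Prop) (f : PMap Ω h → ℝ) : ℝ :=
  (∑ φ : PMap Ω h, if A φ then pmapWeight Ω w φ * f φ else 0) /
  (∑ φ : PMap Ω h, if A φ then pmapWeight Ω w φ else 0)

/-- A colored `𝔯`-partite graph on vertex sets `Ω i`: color sets `C1 i` (for vertices,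
i.e. index-`{i}` edges) and `C2 i j` (for index-`{i,j}` edges), together with coloring
maps, symmetric in the two endpoints. -/
structure CGraph {r : ℕ} (Ω : Fin r → Type) (K₁ K₂ : Type) where
  C1 : Fin r → Finset K₁
  C2 : Fin r → Fin r → Finset K₂
  vCol : ∀ i, Ω i → K₁
  eCol : ∀ i j, Ω i → Ω j → K₂
  eSymm : ∀ i j x y, eCol i j x y = eCol j i y x
  c2Symm : ∀ i j, C2 i j = C2 j i
  vMem : ∀ i x, vCol i x ∈ C1 i
  eMem : ∀ i j x y, eCol i j x y ∈ C2 i j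

/-- `G` is `(b₁,b₂)`-colored: each color set `C_I` has at most `b_{|I|}` elements. -/
def CGraph.Bounded {r : ℕ} {Ω : Fin r → Type} {K₁ K₂ : Type}
    (G : CGraph Ω K₁ K₂) (b₁ b₂ : ℕ) : Prop :=
  (∀ i, (G.C1 i).card ≤ b₁) ∧ ∀ i j, i ≠ j → (G.C2 i j).card ≤ b₂

/-- Relative density `d_G(c)` of a vertex (index-`{i}`) total color `c`:
the probability that a random vertex of `Ω i` has color `c`. -/
noncomputable def dV {r : ℕ} (Ω : Fin r → Type) [∀ i, Fintype (Ω i)]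
    (w : ∀ i, Ω i → ℝ) {K₁ K₂ : Type} (G : CGraph Ω K₁ K₂) (i : Fin r) (c : K₁) : ℝ :=
  ∑ x : Ω i, if G.vCol i x = c then w i x else 0

/-- Relative density `d_G(c₂; ci, cj)` of an index-`{i,j}` total color:
the conditional probability that a random edge has color `c₂` given that its
endpoints have colors `ci`, `cj`. -/
noncomputable def dE {r : ℕ} (Ω : Fin r → Type) [∀ i, Fintype (Ω i)]
    (w : ∀ i, Ω i → ℝ) {K₁ K₂ : Type} (G : CGraph Ω K₁ K₂) (i j : Fin r)
    (c₂ : K₂) (ci cj : K₁) : ℝ :=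
  (∑ x : Ω i, ∑ y : Ω j,
      if G.eCol i j x y = c₂ ∧ G.vCol i x = ci ∧ G.vCol j y = cj then w i x * w j y else 0) /
  (∑ x : Ω i, ∑ y : Ω j, if G.vCol i x = ci ∧ G.vCol j y = cj then w i x * w j y else 0)

/-- A (simplicial) complex with `h` vertices in each of the `r` parts: a colored
partite graph where `none` is the (unique) invisible color of each index, and any
edge containing an invisible vertex is invisible. -/
structure SComplex (r h : ℕ) (K₁ K₂ : Type) where
  vCol : Fin r → Fin h → Option K₁
  eCol : Fin r → Fin r → Fin h → Fin h → Option K₂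
  eSymm : ∀ i j a b, eCol i j a b = eCol j i b a
  loopless : ∀ i a b, eCol i i a b = none
  down : ∀ i j a b, vCol i a = none → eCol i j a b = none

/-- `S ∈ S_{h,G}` : the visible colors of the complex `S` are (identified with)
colors of `G`. -/
def SComplex.MemS {r h : ℕ} {Ω : Fin r → Type} {K₁ K₂ : Type}
    (S : SComplex r h K₁ K₂) (G : CGraph Ω K₁ K₂) : Prop :=
  (∀ i a c, S.vCol i a = some c → c ∈ G.C1 i) ∧
  (∀ i j a b c, S.eCol i j a b = some c → c ∈ G.C2 i j)

/-- `𝕍₁(S)`: the visible vertices of `S`. -/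
noncomputable def V1 {r h : ℕ} {K₁ K₂ : Type} (S : SComplex r h K₁ K₂) :
    Finset (Fin r × Fin h) :=
  univ.filter fun p => S.vCol p.1 p.2 ≠ none

/-- `𝕍₂(S)`: the visible (size-2) edges of `S`, listed once each (`i < j`). -/
noncomputable def V2 {r h : ℕ} {K₁ K₂ : Type} (S : SComplex r h K₁ K₂) :
    Finset (Fin r × Fin r × Fin h × Fin h) :=
  univ.filter fun q => q.1 < q.2.1 ∧ S.eCol q.1 q.2.1 q.2.2.1 q.2.2.2 ≠ none

/-- `d_G(S⟨v⟩)` for a vertex `v` of `S` (junk value `1` on invisible vertices). -/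
noncomputable def dVS {r h : ℕ} (Ω : Fin r → Type) [∀ i, Fintype (Ω i)]
    (w : ∀ i, Ω i → ℝ) {K₁ K₂ : Type} (G : CGraph Ω K₁ K₂)
    (S : SComplex r h K₁ K₂) (p : Fin r × Fin h) : ℝ :=
  match S.vCol p.1 p.2 with
  | some c => dV Ω w G p.1 c
  | none => 1

/-- `d_G(S⟨e⟩)` for a size-2 edge `e` of `S` (junk value `1` on invisible edges). -/
noncomputable def dES {r h : ℕ} (Ω : Fin r → Type) [∀ i, Fintype (Ω i)]
    (w : ∀ i, Ω i → ℝ) {K₁ K₂ : Type} (G : CGraph Ω K₁ K₂)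
    (S : SComplex r h K₁ K₂) (q : Fin r × Fin r × Fin h × Fin h) : ℝ :=
  match S.eCol q.1 q.2.1 q.2.2.1 q.2.2.2, S.vCol q.1 q.2.2.1, S.vCol q.2.1 q.2.2.2 with
  | some c₂, some ci, some cj => dE Ω w G q.1 q.2.1 c₂ ci cj
  | _, _, _ => 1

/-- The event `G(φ(v)) = S(v)` for all visible vertices `v` of `S`. -/
def vEvent {r h : ℕ} {Ω : Fin r → Type} {K₁ K₂ : Type} (G : CGraph Ω K₁ K₂)
    (S : SComplex r h K₁ K₂) (φ : PMap Ω h) : Prop :=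
  ∀ p ∈ V1 S, some (G.vCol p.1 (φ p.1 p.2)) = S.vCol p.1 p.2

/-- The event `G(φ(e)) = S(e)` for all visible size-2 edges `e` of `S`. -/
def eEvent {r h : ℕ} {Ω : Fin r → Type} {K₁ K₂ : Type} (G : CGraph Ω K₁ K₂)
    (S : SComplex r h K₁ K₂) (φ : PMap Ω h) : Prop :=
  ∀ q ∈ V2 S, some (G.eCol q.1 q.2.1 (φ q.1 q.2.2.1) (φ q.2.1 q.2.2.2)) =
    S.eCol q.1 q.2.1 q.2.2.1 q.2.2.2

/-- `P_{φ∈Φ(h)}[G(φ(e)) = S(e) for all e ∈ 𝕍(S)]`. -/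
noncomputable def countProb {r h : ℕ} (Ω : Fin r → Type) [∀ i, Fintype (Ω i)]
    (w : ∀ i, Ω i → ℝ) {K₁ K₂ : Type} (G : CGraph Ω K₁ K₂)
    (S : SComplex r h K₁ K₂) : ℝ :=
  EPhi Ω w h fun φ => if vEvent G S φ ∧ eEvent G S φ then 1 else 0

/-- Value of an error function `δ` (defined on index-2 total colors) at `S⟨e⟩`. -/
noncomputable def deltaS {r h : ℕ} {K₁ K₂ : Type} (δ : Fin r → Fin r → K₂ → K₁ → K₁ → ℝ)
    (S : SComplex r h K₁ K₂) (q : Fin r × Fin r × Fin h × Fin h) : ℝ :=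
  match S.eCol q.1 q.2.1 q.2.2.1 q.2.2.2, S.vCol q.1 q.2.2.1, S.vCol q.2.1 q.2.2.2 with
  | some c₂, some ci, some cj => δ q.1 q.2.1 c₂ ci cj
  | _, _, _ => 0

/-- The counting equation (\ref{lj19}) for one complex `S`:
`P[G(φ(e)) = S(e) ∀ e ∈ 𝕍(S)] = ∏_{v∈𝕍₁(S)} d_G(S⟨v⟩) · ∏_{e∈𝕍₂(S)} (d_G(S⟨e⟩) ±̇ δ(S⟨e⟩))`,
where `a ±̇ b` denotes a suitable number `c` with `max 0 (a-b) ≤ c ≤ min 1 (a+b)`. -/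
def CountEqAt {r h : ℕ} (Ω : Fin r → Type) [∀ i, Fintype (Ω i)]
    (w : ∀ i, Ω i → ℝ) {K₁ K₂ : Type} (G : CGraph Ω K₁ K₂)
    (δ : Fin r → Fin r → K₂ → K₁ → K₁ → ℝ) (S : SComplex r h K₁ K₂) : Prop :=
  ∃ c : Fin r × Fin r × Fin h × Fin h → ℝ,
    (∀ q ∈ V2 S, max 0 (dES Ω w G S q - deltaS δ S q) ≤ c q ∧
        c q ≤ min 1 (dES Ω w G S q + deltaS δ S q)) ∧
    countProb Ω w G S = (∏ p ∈ V1 S, dVS Ω w G S p) * ∏ q ∈ V2 S, c q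

/-- `δ` is an `h`-error function of `G`: the counting equation holds for every
`S ∈ S_{h,G}`. -/
def IsErrorFun {r : ℕ} (Ω : Fin r → Type) [∀ i, Fintype (Ω i)]
    (w : ∀ i, Ω i → ℝ) {K₁ K₂ : Type} (G : CGraph Ω K₁ K₂) (h : ℕ)
    (δ : Fin r → Fin r → K₂ → K₁ → K₁ → ℝ) : Prop :=
  ∀ S : SComplex r h K₁ K₂, S.MemS G → CountEqAt Ω w G δ S

/-- `E_{e∈Ω_I}[δ(G⟨e⟩)]` for `I = {i,j}`. -/
noncomputable def EdgeDeltaAvg {r : ℕ} (Ω : Fin r → Type) [∀ i, Fintype (Ω i)]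
    (w : ∀ i, Ω i → ℝ) {K₁ K₂ : Type} (G : CGraph Ω K₁ K₂)
    (δ : Fin r → Fin r → K₂ → K₁ → K₁ → ℝ) (i j : Fin r) : ℝ :=
  ∑ x : Ω i, ∑ y : Ω j,
    w i x * w j y * δ i j (G.eCol i j x y) (G.vCol i x) (G.vCol j y)

/-- `G` is `(ε,h)`-regular. -/
def IsRegularG {r : ℕ} (Ω : Fin r → Type) [∀ i, Fintype (Ω i)]
    (w : ∀ i, Ω i → ℝ) {K₁ K₂ : Type} (G : CGraph Ω K₁ K₂) (h : ℕ) (ε : ℝ) : Prop :=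
  ∃ δ : Fin r → Fin r → K₂ → K₁ → K₁ → ℝ,
    (∀ i j c₂ ci cj, 0 ≤ δ i j c₂ ci cj) ∧
    IsErrorFun Ω w G h δ ∧
    ∀ i j : Fin r, i ≠ j → EdgeDeltaAvg Ω w G δ i j ≤ ε / (G.C2 i j).card

/-- `reg_h(G)`: the minimum `ε` such that `G` is `(ε,h)`-regular. -/
noncomputable def reg {r : ℕ} (Ω : Fin r → Type) [∀ i, Fintype (Ω i)]
    (w : ∀ i, Ω i → ℝ) {K₁ K₂ : Type} (G : CGraph Ω K₁ K₂) (h : ℕ) : ℝ :=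
  sInf {ε : ℝ | IsRegularG Ω w G h ε}

/-- The regularization `G/φ` of `G` by a partitionwise map `φ ∈ Φ(m)`: each vertex
`v ∈ Ω i` is recolored by its original color together with the colors of all edges
joining `v` to the sample points of `φ` in the other parts. Size-2 edges keep
their colors. -/
noncomputable def regz {r : ℕ} (Ω : Fin r → Type) [∀ i, Fintype (Ω i)]
    {K₁ K₂ : Type} [Fintype K₁] [Fintype K₂] (G : CGraph Ω K₁ K₂) {m : ℕ}
    (φ : PMap Ω m) : CGraph Ω (K₁ × (Fin r → Fin m → Option K₂)) K₂ where
  C1 i := univ.filter fun p : K₁ × (Fin r → Fin m → Option K₂) =>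
    p.1 ∈ G.C1 i ∧ ∀ j b, if j = i then p.2 j b = none
      else ∃ c ∈ G.C2 i j, p.2 j b = some c
  C2 := G.C2
  vCol i x := (G.vCol i x, fun j b => if j = i then none else some (G.eCol i j x (φ j b)))
  eCol := G.eCol
  eSymm := G.eSymm
  c2Symm := G.c2Symm
  vMem := by
    intro i x
    simp only [mem_filter, mem_univ, true_and]
    refine ⟨G.vMem i x, fun j b => ?_⟩
    by_cases hj : j = i
    · simp [hj]
    · simp only [hj, if_neg hj]
      exact ⟨G.eCol i j x (φ j b), G.eMem i j x (φ j b), rfl⟩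
  eMem := G.eMem

/-- Conditional expectation of `f` over a random pair `e = (x,y) ∈ Ω_{i} × Ω_{j}`
given the event `A`. -/
noncomputable def condEE {r : ℕ} (Ω : Fin r → Type) [∀ i, Fintype (Ω i)]
    (w : ∀ i, Ω i → ℝ) (i j : Fin r) (A : Ω i → Ω j → Prop) (f : Ω i → Ω j → ℝ) : ℝ :=
  (∑ x : Ω i, ∑ y : Ω j, if A x y then w i x * w j y * f x y else 0) /
  (∑ x : Ω i, ∑ y : Ω j, if A x y then w i x * w j y else 0)

/-- `e ≈_{∂(G/ψ)} e'` : the two pairs have the same frame color in the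
regularization `G/ψ`. -/
def frameRel {r : ℕ} (Ω : Fin r → Type) [∀ i, Fintype (Ω i)]
    {K₁ K₂ : Type} [Fintype K₁] [Fintype K₂] (G : CGraph Ω K₁ K₂) {m : ℕ}
    (ψ : PMap Ω m) (i j : Fin r) (x : Ω i) (y : Ω j) (x' : Ω i) (y' : Ω j) : Prop :=
  (regz Ω G ψ).vCol i x = (regz Ω G ψ).vCol i x' ∧
  (regz Ω G ψ).vCol j y = (regz Ω G ψ).vCol j y'

/-- `η(c₂; ci, cj)` (eq. (\ref{061220})) computed in `G`, with `N` random sample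
vertices in each part (`N = M·h` in the paper). -/
noncomputable def eta {r : ℕ} (Ω : Fin r → Type) [∀ i, Fintype (Ω i)]
    (w : ∀ i, Ω i → ℝ) {K₁ K₂ : Type} [Fintype K₁] [Fintype K₂]
    (G : CGraph Ω K₁ K₂) (N : ℕ) (i j : Fin r) (c₂ : K₂) (ci cj : K₁) : ℝ :=
  EPhi Ω w N fun ψ =>
    condEE Ω w i j (fun x' y' => G.vCol i x' = ci ∧ G.vCol j y' = cj) fun x' y' =>
      (condEE Ω w i j (fun x y => frameRel Ω G ψ i j x y x' y')
          (fun x y => if G.eCol i j x y = c₂ then 1 else 0) -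
        dE Ω w G i j c₂ ci cj) ^ 2

/-- `η(S⟨e⟩)` for a size-2 edge of a complex `S` (junk value `0` if invisible). -/
noncomputable def etaS {r h : ℕ} (Ω : Fin r → Type) [∀ i, Fintype (Ω i)]
    (w : ∀ i, Ω i → ℝ) {K₁ K₂ : Type} [Fintype K₁] [Fintype K₂]
    (G : CGraph Ω K₁ K₂) (N : ℕ) (S : SComplex r h K₁ K₂)
    (q : Fin r × Fin r × Fin h × Fin h) : ℝ :=
  match S.eCol q.1 q.2.1 q.2.2.1 q.2.2.2, S.vCol q.1 q.2.2.1, S.vCol q.2.1 q.2.2.2 with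
  | some c₂, some ci, some cj => eta Ω w G N q.1 q.2.1 c₂ ci cj
  | _, _, _ => 0

/-- `ε₁ := (ε/(6 b₂ binom(r,2)))²`. -/
noncomputable def eps1 (r b₂ : ℕ) (ε : ℝ) : ℝ := (ε / (6 * b₂ * r.choose 2)) ^ 2

/-- `C := √2 · binom(r,2) h² · (b₂/√ε₁)^{binom(r,2)h² − 1}`. -/
noncomputable def Cconst (r h b₂ : ℕ) (ε : ℝ) : ℝ :=
  Real.sqrt 2 * r.choose 2 * h ^ 2 *
    ((b₂ : ℝ) / Real.sqrt (eps1 r b₂ ε)) ^ (r.choose 2 * h ^ 2 - 1)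

/-- `M(m) := (b₁ b₂^{(r−1)m} / √ε₁)^{rh}` (as a sample count). -/
noncomputable def Mconst (r h b₁ b₂ : ℕ) (ε : ℝ) (m : ℕ) : ℕ :=
  ⌈(((b₁ : ℝ) * (b₂ : ℝ) ^ ((r - 1) * m)) / Real.sqrt (eps1 r b₂ ε)) ^ (r * h)⌉₊

/-- A vertex total color `c` of index `{i}` is bad. -/
def BadV {r : ℕ} (Ω : Fin r → Type) [∀ i, Fintype (Ω i)]
    (w : ∀ i, Ω i → ℝ) {K₁ K₂ : Type} (G : CGraph Ω K₁ K₂) (ε₁ : ℝ)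
    (i : Fin r) (c : K₁) : Prop :=
  dV Ω w G i c ≤ Real.sqrt ε₁ / (G.C1 i).card

/-- An index-`{i,j}` total color `(c₂; ci, cj)` is bad: some nonempty `I* ⊆ {i,j}`
has relative density at most `√ε₁/|C_{I*}|`. -/
def BadE {r : ℕ} (Ω : Fin r → Type) [∀ i, Fintype (Ω i)]
    (w : ∀ i, Ω i → ℝ) {K₁ K₂ : Type} (G : CGraph Ω K₁ K₂) (ε₁ : ℝ)
    (i j : Fin r) (c₂ : K₂) (ci cj : K₁) : Prop :=
  BadV Ω w G ε₁ i ci ∨ BadV Ω w G ε₁ j cj ∨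
    dE Ω w G i j c₂ ci cj ≤ Real.sqrt ε₁ / (G.C2 i j).card

/-- The error function `δ` of the paper: `1` on bad total colors, `C·√η` otherwise. -/
noncomputable def deltaDef {r : ℕ} (Ω : Fin r → Type) [∀ i, Fintype (Ω i)]
    (w : ∀ i, Ω i → ℝ) {K₁ K₂ : Type} [Fintype K₁] [Fintype K₂]
    (G : CGraph Ω K₁ K₂) (ε₁ Cc : ℝ) (N : ℕ)
    (i j : Fin r) (c₂ : K₂) (ci cj : K₁) : ℝ :=
  if BadE Ω w G ε₁ i j c₂ ci cj then 1 else Cc * Real.sqrt (eta Ω w G N i j c₂ ci cj)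

/-- `∏_{e∈D}(𝟙[G(φ(e)) = S(e)] − d_G(S⟨e⟩))`, single factor. -/
noncomputable def indMinusD {r h : ℕ} (Ω : Fin r → Type) [∀ i, Fintype (Ω i)]
    (w : ∀ i, Ω i → ℝ) {K₁ K₂ : Type} (G : CGraph Ω K₁ K₂)
    (S : SComplex r h K₁ K₂) (φ : PMap Ω h) (q : Fin r × Fin r × Fin h × Fin h) : ℝ :=
  (if some (G.eCol q.1 q.2.1 (φ q.1 q.2.2.1) (φ q.2.1 q.2.2.2)) =
      S.eCol q.1 q.2.1 q.2.2.1 q.2.2.2 then 1 else 0) - dES Ω w G S q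

/-! ## Finite product expectations -/

noncomputable def EP {ι : Type} [Fintype ι] [DecidableEq ι] {X : ι → Type} [∀ i, Fintype (X i)]
    (w : ∀ i, X i → ℝ) (F : (∀ i, X i) → ℝ) : ℝ :=
  ∑ φ : ∀ i, X i, (∏ i, w i (φ i)) * F φ

section EPsec
variable {ι : Type} [Fintype ι] [DecidableEq ι] {X : ι → Type} [∀ i, Fintype (X i)]
    (w : ∀ i, X i → ℝ)

theorem EP_prod (g : ∀ i, X i → ℝ) :
    EP w (fun φ => ∏ i, g i (φ i)) = ∏ i, ∑ x, w i x * g i x := by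
  rw [Finset.prod_univ_sum]
  simp only [EP, Fintype.piFinset_univ, Finset.prod_mul_distrib]

theorem EP_mono (hw : ∀ i x, 0 ≤ w i x) {F F' : (∀ i, X i) → ℝ} (h : ∀ φ, F φ ≤ F' φ) :
    EP w F ≤ EP w F' :=
  Finset.sum_le_sum fun φ _ =>
    mul_le_mul_of_nonneg_left (h φ) (Finset.prod_nonneg fun i _ => hw i _)

theorem EP_abs (hw : ∀ i x, 0 ≤ w i x) (F : (∀ i, X i) → ℝ) :
    |EP w F| ≤ EP w (fun φ => |F φ|) := by
  refine (Finset.abs_sum_le_sum_abs _ _).trans (le_of_eq ?_)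
  refine Finset.sum_congr rfl fun φ _ => ?_
  rw [abs_mul, abs_of_nonneg (Finset.prod_nonneg fun i _ => hw i _)]

theorem EP_smul (a : ℝ) (F : (∀ i, X i) → ℝ) : EP w (fun φ => a * F φ) = a * EP w F := by
  simp only [EP, Finset.mul_sum]
  exact Finset.sum_congr rfl fun φ _ => by ring

theorem EP_add (F F' : (∀ i, X i) → ℝ) :
    EP w (fun φ => F φ + F' φ) = EP w F + EP w F' := by
  simp only [EP, ← Finset.sum_add_distrib, mul_add]

theorem EP_resample (hs : ∀ i, ∑ x, w i x = 1) (p : ι) (F : (∀ i, X i) → ℝ) :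
    EP w F = EP w (fun φ => ∑ x, w p x * F (Function.update φ p x)) := by
  have hW : ∀ (φ : ∀ i, X i) (x : X p),
      (∏ i, w i (φ i)) * w p x = (∏ i, w i (Function.update φ p x i)) * w p (φ p) := by
    intro φ x
    rw [← Finset.mul_prod_erase univ _ (Finset.mem_univ p),
      ← Finset.mul_prod_erase univ (fun i => w i (Function.update φ p x i)) (Finset.mem_univ p)]
    have : ∏ i ∈ univ.erase p, w i (Function.update φ p x i) = ∏ i ∈ univ.erase p, w i (φ i) := by
      refine Finset.prod_congr rfl fun i hi => ?_
      rw [Function.update_of_ne (Finset.ne_of_mem_erase hi)]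
    rw [this]
    simp only [Function.update_self]
    ring
  have h1 : EP w F = ∑ z : (∀ i, X i) × X p, (∏ i, w i (z.1 i)) * w p z.2 * F z.1 := by
    rw [Fintype.sum_prod_type]
    refine Finset.sum_congr rfl fun φ _ => ?_
    simp only
    rw [← Finset.sum_mul, ← Finset.mul_sum, hs, mul_one]
  have h2 : EP w (fun φ => ∑ x, w p x * F (Function.update φ p x)) =
      ∑ z : (∀ i, X i) × X p, (∏ i, w i (z.1 i)) * w p z.2 * F (Function.update z.1 p z.2) := by
    rw [Fintype.sum_prod_type]
    refine Finset.sum_congr rfl fun φ _ => ?_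
    simp only
    rw [Finset.mul_sum]
    exact Finset.sum_congr rfl fun x _ => by ring
  rw [h1, h2]
  refine Finset.sum_nbij' (fun z => (Function.update z.1 p z.2, z.1 p))
    (fun z => (Function.update z.1 p z.2, z.1 p)) (by simp) (by simp) ?_ ?_ ?_
  · rintro ⟨φ, x⟩ _; simp
  · rintro ⟨φ, x⟩ _; simp
  · rintro ⟨φ, x⟩ _
    simp only [Function.update_idem, Function.update_eq_self]
    rw [hW]

theorem EP_const (hs : ∀ i, ∑ x, w i x = 1) (a : ℝ) : EP w (fun _ => a) = a := by
  have := EP_prod w (fun _ _ => (1 : ℝ))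
  simp only [mul_one, hs, Finset.prod_const_one] at this
  have h2 := EP_smul w a (fun _ => 1)
  rw [this] at h2
  simpa using h2

theorem EP_marg2 (hs : ∀ i, ∑ x, w i x = 1) {p p' : ι} (hp : p ≠ p')
    (F : X p → X p' → ℝ) :
    EP w (fun φ => F (φ p) (φ p')) = ∑ x, ∑ y, w p x * w p' y * F x y := by
  rw [EP_resample w hs p]
  simp only [Function.update_self, Function.update_of_ne hp.symm]
  rw [EP_resample w hs p']
  simp only [Function.update_self]
  rw [EP_const w hs]
  simp only [Finset.mul_sum]
  rw [Finset.sum_comm]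
  exact Finset.sum_congr rfl fun x _ => Finset.sum_congr rfl fun y _ => by ring

theorem EP_prod_split (g : ∀ i, X i → ℝ) (φ : ∀ i, X i) {p p' : ι} (hp : p ≠ p')
    (x : X p) (y : X p') :
    ∏ i, g i (Function.update (Function.update φ p x) p' y i) =
      g p x * g p' y * ∏ i ∈ (univ.erase p).erase p', g i (φ i) := by
  rw [← Finset.mul_prod_erase univ _ (Finset.mem_univ p),
    ← Finset.mul_prod_erase (univ.erase p) _
      (Finset.mem_erase.2 ⟨hp.symm, Finset.mem_univ p'⟩)]
  have : ∏ i ∈ (univ.erase p).erase p',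
      g i (Function.update (Function.update φ p x) p' y i) =
      ∏ i ∈ (univ.erase p).erase p', g i (φ i) := by
    refine Finset.prod_congr rfl fun i hi => ?_
    have h1 := Finset.ne_of_mem_erase hi
    have h2 := Finset.ne_of_mem_erase (Finset.mem_of_mem_erase hi)
    rw [Function.update_of_ne h1, Function.update_of_ne h2]
  rw [this, Function.update_of_ne hp, Function.update_self, Function.update_self]
  ring

theorem count_step (hw : ∀ i x, 0 ≤ w i x) (hs : ∀ i, ∑ x, w i x = 1)
    (g : ∀ i, X i → ℝ) (hg : ∀ i x, 0 ≤ g i x)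
    {Q : Type} (s t : Q → ι)     (e : ∀ q, X (s q) → X (t q) → ℝ) (he : ∀ q x y, 0 ≤ e q x y ∧ e q x y ≤ 1)
    (d : ℝ) (κ : ℝ) (F : Finset Q) (q : Q) (hq : q ∉ F)
    (hst' : s q ≠ t q)
    (hinj : ∀ q' ∈ F, q ≠ q' →
      ¬ ((s q = s q' ∨ s q = t q') ∧ (t q = s q' ∨ t q = t q')))
    (hcut : ∀ (u : X (s q) → ℝ) (v : X (t q) → ℝ), (∀ x, 0 ≤ u x ∧ u x ≤ 1) →
      (∀ y, 0 ≤ v y ∧ v y ≤ 1) →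
      |∑ x, ∑ y, w (s q) x * w (t q) y * (g (s q) x * g (t q) y * (u x * v y * (e q x y - d)))|
        ≤ κ * ((∑ x, w (s q) x * g (s q) x) * (∑ y, w (t q) y * g (t q) y))) :
    |EP w (fun φ => (∏ p, g p (φ p)) * (∏ q' ∈ F, e q' (φ (s q')) (φ (t q'))) *
        (e q (φ (s q)) (φ (t q)) - d))| ≤ κ * ∏ p, ∑ x, w p x * g p x := by
  rw [EP_resample w hs (s q), EP_resample w hs (t q)]
  -- right side
  have hR : κ * ∏ p, ∑ x, w p x * g p x = EP w (fun φ => κ * (∑ y, w (t q) y * ∑ x, w (s q) x *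
      ∏ p, g p (Function.update (Function.update φ (s q) x) (t q) y p))) := by
    rw [← EP_prod, EP_smul, EP_resample w hs (s q), EP_resample w hs (t q)]
    simp only [Function.update_comm hst']
  rw [hR]
  refine (EP_abs w hw _).trans (EP_mono w hw fun φ => ?_)
  simp only [Function.update_comm hst'.symm]
  set rest := ∏ i ∈ (univ.erase (s q)).erase (t q), g i (φ i) with hrest
  have hrest0 : 0 ≤ rest := Finset.prod_nonneg fun i _ => hg i _
  let u : X (s q) → ℝ := fun x => ∏ q' ∈ F.filter (fun q' => ¬ (t q = s q' ∨ t q = t q')),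
    e q' (Function.update φ (s q) x (s q')) (Function.update φ (s q) x (t q'))
  let v : X (t q) → ℝ := fun y => ∏ q' ∈ F.filter (fun q' => (t q = s q' ∨ t q = t q')),
    e q' (Function.update φ (t q) y (s q')) (Function.update φ (t q) y (t q'))
  have hu : ∀ x, 0 ≤ u x ∧ u x ≤ 1 := fun x =>
    ⟨Finset.prod_nonneg fun i _ => (he _ _ _).1,
     Finset.prod_le_one (fun i _ => (he _ _ _).1) fun i _ => (he _ _ _).2⟩
  have hv : ∀ x, 0 ≤ v x ∧ v x ≤ 1 := fun x =>
    ⟨Finset.prod_nonneg fun i _ => (he _ _ _).1,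
     Finset.prod_le_one (fun i _ => (he _ _ _).1) fun i _ => (he _ _ _).2⟩
  have huv : ∀ x y, ∏ q' ∈ F,
      e q' (Function.update (Function.update φ (s q) x) (t q) y (s q'))
        (Function.update (Function.update φ (s q) x) (t q) y (t q')) = u x * v y := by
    intro x y
    rw [← Finset.prod_filter_mul_prod_filter_not F (fun q' => (t q = s q' ∨ t q = t q')),
      mul_comm]
    congr 1
    · refine Finset.prod_congr rfl fun q' hq' => ?_
      have := (Finset.mem_filter.1 hq').2
      push Not at this
      rw [Function.update_of_ne this.1.symm, Function.update_of_ne this.2.symm]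
    · refine Finset.prod_congr rfl fun q' hq' => ?_
      have h1 := Finset.mem_filter.1 hq'
      have hne : q ≠ q' := fun h => hq (h ▸ h1.1)
      have h2 : ¬ (s q = s q' ∨ s q = t q') := fun h => hinj q' h1.1 hne ⟨h, h1.2⟩
      push Not at h2
      rw [Function.update_comm hst', Function.update_of_ne h2.1.symm,
        Function.update_of_ne h2.2.symm]
  have hL : (∑ y, w (t q) y * ∑ x, w (s q) x *
      ((∏ p, g p (Function.update (Function.update φ (s q) x) (t q) y p)) *
        (∏ q' ∈ F, e q' (Function.update (Function.update φ (s q) x) (t q) y (s q'))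
        (Function.update (Function.update φ (s q) x) (t q) y (t q'))) *
        (e q (Function.update (Function.update φ (s q) x) (t q) y (s q))
          (Function.update (Function.update φ (s q) x) (t q) y (t q)) - d))) =
      rest * ∑ x, ∑ y, w (s q) x * w (t q) y *
        (g (s q) x * g (t q) y * (u x * v y * (e q x y - d))) := by
    simp only [Finset.mul_sum]
    rw [Finset.sum_comm]
    refine Finset.sum_congr rfl fun x _ => Finset.sum_congr rfl fun y _ => ?_
    rw [huv, EP_prod_split g φ hst', Function.update_self, Function.update_of_ne hst',
      Function.update_self]
    ring
  have hRR : (∑ y, w (t q) y * ∑ x, w (s q) x *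
      ∏ p, g p (Function.update (Function.update φ (s q) x) (t q) y p)) =
      rest * ((∑ x, w (s q) x * g (s q) x) * (∑ y, w (t q) y * g (t q) y)) := by
    rw [Finset.sum_mul_sum]
    simp only [Finset.mul_sum]
    rw [Finset.sum_comm]
    refine Finset.sum_congr rfl fun x _ => Finset.sum_congr rfl fun y _ => ?_
    rw [EP_prod_split g φ hst']
    ring
  have key := hcut u v hu hv
  have e1 : κ * (rest * ((∑ x, w (s q) x * g (s q) x) * (∑ y, w (t q) y * g (t q) y))) =
    rest * (κ * ((∑ x, w (s q) x * g (s q) x) * (∑ y, w (t q) y * g (t q) y))) := by ring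
  rw [hL, hRR, abs_mul, abs_of_nonneg hrest0, e1]
  exact mul_le_mul_of_nonneg_left key hrest0

theorem count_abs (hw : ∀ i x, 0 ≤ w i x) (hs : ∀ i, ∑ x, w i x = 1)
    (g : ∀ i, X i → ℝ) (hg : ∀ i x, 0 ≤ g i x)
    {Q : Type} (s t : Q → ι) 
    (e : ∀ q, X (s q) → X (t q) → ℝ) (he : ∀ q x y, 0 ≤ e q x y ∧ e q x y ≤ 1)
    (d : Q → ℝ) (hd : ∀ q, 0 ≤ d q ∧ d q ≤ 1) (κ : ℝ) (F : Finset Q)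
    (hst : ∀ q ∈ F, s q ≠ t q)
    (hinj : ∀ q ∈ F, ∀ q' ∈ F, q ≠ q' →
      ¬ ((s q = s q' ∨ s q = t q') ∧ (t q = s q' ∨ t q = t q')))
    (hcut : ∀ q ∈ F, ∀ (u : X (s q) → ℝ) (v : X (t q) → ℝ), (∀ x, 0 ≤ u x ∧ u x ≤ 1) →
      (∀ y, 0 ≤ v y ∧ v y ≤ 1) →
      |∑ x, ∑ y, w (s q) x * w (t q) y *
          (g (s q) x * g (t q) y * (u x * v y * (e q x y - d q)))|
        ≤ κ * ((∑ x, w (s q) x * g (s q) x) * (∑ y, w (t q) y * g (t q) y))) :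
    |EP w (fun φ => (∏ p, g p (φ p)) * (∏ q' ∈ F, e q' (φ (s q')) (φ (t q')))) -
        (∏ p, ∑ x, w p x * g p x) * ∏ q' ∈ F, d q'|
      ≤ F.card * (κ * ∏ p, ∑ x, w p x * g p x) := by
  induction F using Finset.induction_on with
  | empty => simp [EP_prod]
  | insert q F hq ih =>
    have ih' := ih (fun q' hq' => hst q' (Finset.mem_insert_of_mem hq'))
      (fun q' hq' q'' hq'' => hinj q' (Finset.mem_insert_of_mem hq') q''
        (Finset.mem_insert_of_mem hq'')) fun q' hq' => hcut q' (Finset.mem_insert_of_mem hq')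
    have st := count_step w hw hs g hg s t e he (d q) κ F q hq
      (hst q (Finset.mem_insert_self _ _))
      (fun q' hq' => hinj q (Finset.mem_insert_self _ _) q' (Finset.mem_insert_of_mem hq'))
      (hcut q (Finset.mem_insert_self _ _))
    rw [Finset.card_insert_of_notMem hq, Finset.prod_insert hq]
    have e1 : EP w (fun φ => (∏ p, g p (φ p)) *
        (∏ q' ∈ insert q F, e q' (φ (s q')) (φ (t q')))) =
        EP w (fun φ => (∏ p, g p (φ p)) * (∏ q' ∈ F, e q' (φ (s q')) (φ (t q'))) *
        (e q (φ (s q)) (φ (t q)) - d q)) + d q *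
        EP w (fun φ => (∏ p, g p (φ p)) * (∏ q' ∈ F, e q' (φ (s q')) (φ (t q')))) := by
      rw [← EP_smul, ← EP_add]
      congr 1
      funext φ
      rw [Finset.prod_insert hq]
      ring
    rw [e1]
    set A := EP w (fun φ => (∏ p, g p (φ p)) * (∏ q' ∈ F, e q' (φ (s q')) (φ (t q'))) *
        (e q (φ (s q)) (φ (t q)) - d q))
    set B := EP w (fun φ => (∏ p, g p (φ p)) * (∏ q' ∈ F, e q' (φ (s q')) (φ (t q'))))
    set P := ∏ p, ∑ x, w p x * g p x
    have e2 : A + d q * B - P * (d q * ∏ q' ∈ F, d q') =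
      A + d q * (B - P * ∏ q' ∈ F, d q') := by ring
    rw [e2]
    refine (abs_add_le _ _).trans ?_
    rw [abs_mul, abs_of_nonneg (hd q).1]
    have : d q * |B - P * ∏ q' ∈ F, d q'| ≤ 1 * |B - P * ∏ q' ∈ F, d q'| :=
      mul_le_mul_of_nonneg_right (hd q).2 (abs_nonneg _)
    push_cast
    linarith

end EPsec
/-! ## Conditional expectations on a finite space -/

noncomputable def ce {Z C : Type} [Fintype Z] (μ : Z → ℝ) (c : Z → C) (f : Z → ℝ) (γ : C) : ℝ :=
  (∑ z, if c z = γ then μ z * f z else 0) / (∑ z, if c z = γ then μ z else 0)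

/-- indicator of equality -/
noncomputable def ei {C : Type} (a b : C) : ℝ := if a = b then 1 else 0

theorem ei_bd {C : Type} (a b : C) : 0 ≤ ei a b ∧ ei a b ≤ 1 := by
  unfold ei; split_ifs <;> norm_num

theorem ei_self {C : Type} (a : C) : ei a a = 1 := by simp [ei]

theorem ei_of_ne {C : Type} {a b : C} (h : a ≠ b) : ei a b = 0 := by simp [ei, h]

section CEsec
variable {Z C C' C'' : Type} [Fintype Z] (μ : Z → ℝ) (hμ : ∀ z, 0 ≤ μ z)

theorem ce_tower (hμ : ∀ z, 0 ≤ μ z) (c : Z → C) (K f : Z → ℝ)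
    (hK : ∀ z z', c z = c z' → K z = K z') :
    ∑ z, μ z * (K z * ce μ c f (c z)) = ∑ z, μ z * (K z * f z) := by
  have h1 : ∀ z, μ z * (K z * ce μ c f (c z)) =
      ∑ z', if c z' = c z then (μ z' * (K z' * f z')) *
        (μ z / (∑ z, if c z = c z' then μ z else 0)) else 0 := by
    intro z
    rw [ce, Finset.sum_div, Finset.mul_sum, Finset.mul_sum]
    refine Finset.sum_congr rfl fun z' _ => ?_
    split_ifs with h
    · rw [h, hK z' z h]
      ring
    · simp
  simp only [h1]
  rw [Finset.sum_comm]
  refine Finset.sum_congr rfl fun z' _ => ?_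
  have h2 : ∑ z, (if c z' = c z then (μ z' * (K z' * f z')) *
        (μ z / (∑ z, if c z = c z' then μ z else 0)) else 0) =
      (μ z' * (K z' * f z')) * ((∑ z, if c z = c z' then μ z else 0) /
        (∑ z, if c z = c z' then μ z else 0)) := by
    rw [Finset.sum_div, Finset.mul_sum]
    refine Finset.sum_congr rfl fun z _ => ?_
    by_cases h : c z' = c z
    · rw [if_pos h, if_pos h.symm]
    · rw [if_neg h, if_neg (fun h' => h h'.symm)]
      simp
  rw [h2]
  by_cases h0 : (∑ z, if c z = c z' then μ z else 0) = 0
  · have : μ z' = 0 := by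
      have h3 := (Finset.sum_eq_zero_iff_of_nonneg (fun z _ => by
        split_ifs
        · exact hμ z
        · exact le_rfl)).1 h0 z' (Finset.mem_univ _)
      simpa using h3
    rw [this]; simp
  · rw [div_self h0, mul_one]

theorem ce_pyth (hμ : ∀ z, 0 ≤ μ z) (c : Z → C) (c' : Z → C')
    (hc : ∀ z z', c' z = c' z' → c z = c z') (K f : Z → ℝ)
    (hK : ∀ z z', c z = c z' → K z = K z') :
    ∑ z, μ z * (K z * ce μ c' f (c' z) ^ 2) =
      ∑ z, μ z * (K z * ce μ c f (c z) ^ 2) +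
      ∑ z, μ z * (K z * (ce μ c' f (c' z) - ce μ c f (c z)) ^ 2) := by
  have h1 := ce_tower μ hμ c' (fun z => K z * ce μ c f (c z)) f
    (fun z z' h => by rw [hc z z' h, hK z z' (hc z z' h)])
  have h2 := ce_tower μ hμ c (fun z => K z * ce μ c f (c z)) f
    (fun z z' h => by rw [h, hK z z' h])
  have h3 := h1.trans h2.symm
  have h4 : ∑ z, μ z * (K z * (ce μ c' f (c' z) - ce μ c f (c z)) ^ 2) =
      ∑ z, μ z * (K z * ce μ c' f (c' z) ^ 2)
      - 2 * ∑ z, μ z * (K z * ce μ c f (c z) * ce μ c' f (c' z))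
      + ∑ z, μ z * (K z * ce μ c f (c z) ^ 2) := by
    rw [Finset.mul_sum, ← Finset.sum_sub_distrib, ← Finset.sum_add_distrib]
    exact Finset.sum_congr rfl fun z _ => by ring
  have h5 : ∑ z, μ z * (K z * ce μ c f (c z) * ce μ c f (c z)) =
      ∑ z, μ z * (K z * ce μ c f (c z) ^ 2) :=
    Finset.sum_congr rfl fun z _ => by ring
  rw [h4, h3, h5]
  ring

theorem ce_mono (hμ : ∀ z, 0 ≤ μ z) (c : Z → C) (c' : Z → C') (c'' : Z → C'')
    (hc : ∀ z z', c' z = c' z' → c z = c z') (hc' : ∀ z z', c'' z = c'' z' → c' z = c' z')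
    (K f : Z → ℝ) (hK0 : ∀ z, 0 ≤ K z)
    (hK : ∀ z z', c z = c z' → K z = K z') :
    ∑ z, μ z * (K z * (ce μ c' f (c' z) - ce μ c f (c z)) ^ 2) ≤
      ∑ z, μ z * (K z * (ce μ c'' f (c'' z) - ce μ c f (c z)) ^ 2) := by
  have h1 := ce_pyth μ hμ c c' hc K f hK
  have h2 := ce_pyth μ hμ c c'' (fun z z' h => hc _ _ (hc' _ _ h)) K f hK
  have h3 := ce_pyth μ hμ c' c'' hc' K f (fun z z' h => hK _ _ (hc _ _ h))
  have h4 : 0 ≤ ∑ z, μ z * (K z * (ce μ c'' f (c'' z) - ce μ c' f (c' z)) ^ 2) :=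
    Finset.sum_nonneg fun z _ => mul_nonneg (hμ z) (mul_nonneg (hK0 z) (sq_nonneg _))
  linarith

theorem ce_congr (c : Z → C) (c' : Z → C') (hc : ∀ z z', c z = c z' ↔ c' z = c' z')
    (f : Z → ℝ) (z : Z) : ce μ c f (c z) = ce μ c' f (c' z) := by
  simp only [ce, hc]

theorem ce_nonneg (hμ : ∀ z, 0 ≤ μ z) (c : Z → C) (f : Z → ℝ) (hf : ∀ z, 0 ≤ f z) (γ : C) :
    0 ≤ ce μ c f γ := by
  refine div_nonneg (Finset.sum_nonneg fun z _ => ?_) (Finset.sum_nonneg fun z _ => ?_)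
  · split_ifs
    · exact mul_nonneg (hμ z) (hf z)
    · exact le_rfl
  · split_ifs
    · exact hμ z
    · exact le_rfl

theorem ce_le_one (hμ : ∀ z, 0 ≤ μ z) (c : Z → C) (f : Z → ℝ) (hf : ∀ z, f z ≤ 1) (γ : C) :
    ce μ c f γ ≤ 1 := by
  refine div_le_one_of_le₀ (Finset.sum_le_sum fun z _ => ?_) (Finset.sum_nonneg fun z _ => ?_)
  · split_ifs
    · exact mul_le_of_le_one_right (hμ z) (hf z)
    · exact le_rfl
  · split_ifs
    · exact hμ z
    · exact le_rfl

/-- correlation bound on one class -/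
theorem ce_corr (hμ : ∀ z, 0 ≤ μ z) (c : Z → C) (c' : Z → C')
    (hc : ∀ z z', c' z = c' z' → c z = c z') (γ : C) (f U : Z → ℝ)
    (hU : ∀ z z', c' z = c' z' → U z = U z') (hU1 : ∀ z, |U z| ≤ 1) :
    (∑ z, μ z * (ei (c z) γ * (U z * (f z - ce μ c f γ)))) ^ 2 ≤
      (∑ z, μ z * ei (c z) γ) *
      ∑ z, μ z * (ei (c z) γ * (ce μ c' f (c' z) - ce μ c f (c z)) ^ 2) := by
  have h1 := ce_tower μ hμ c' (fun z => ei (c z) γ * U z) f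
    (fun z z' h => by rw [hc z z' h, hU z z' h])
  have h2 : ∑ z, μ z * (ei (c z) γ * (U z * (f z - ce μ c f γ))) =
      ∑ z, (μ z * ei (c z) γ) * (U z * (ce μ c' f (c' z) - ce μ c f (c z))) := by
    have e1 : ∑ z, μ z * (ei (c z) γ * (U z * (f z - ce μ c f γ))) =
      ∑ z, μ z * (ei (c z) γ * U z * f z) -
      ∑ z, μ z * (ei (c z) γ * U z * ce μ c f γ) := by
      rw [← Finset.sum_sub_distrib]
      exact Finset.sum_congr rfl fun z _ => by ring
    rw [e1, ← h1, ← Finset.sum_sub_distrib]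
    refine Finset.sum_congr rfl fun z _ => ?_
    by_cases h : c z = γ
    · rw [h]; ring
    · rw [ei_of_ne h]; ring
  rw [h2]
  have hm : ∀ z, 0 ≤ μ z * ei (c z) γ := fun z =>
    mul_nonneg (hμ z) (ei_bd _ _).1
  have cs := Finset.sum_sq_le_sum_mul_sum_of_sq_le_mul univ
    (r := fun z => (μ z * ei (c z) γ) * (U z * (ce μ c' f (c' z) - ce μ c f (c z))))
    (f := fun z => μ z * ei (c z) γ)
    (g := fun z => (μ z * ei (c z) γ) *
      (U z * (ce μ c' f (c' z) - ce μ c f (c z))) ^ 2)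
    (fun z _ => hm z) (fun z _ => mul_nonneg (hm z) (sq_nonneg _))
    (fun z _ => le_of_eq (by ring))
  refine cs.trans ?_
  refine mul_le_mul_of_nonneg_left ?_ (Finset.sum_nonneg fun z _ => hm z)
  refine Finset.sum_le_sum fun z _ => ?_
  rw [← mul_assoc]
  refine mul_le_mul_of_nonneg_left ?_ (hm z)
  rw [mul_pow]
  have : U z ^ 2 ≤ 1 := by
    rw [← sq_abs]
    exact pow_le_one₀ (abs_nonneg _) (hU1 z)
  exact mul_le_of_le_one_left (sq_nonneg _) this

end CEsec

theorem wcs {Z : Type} [Fintype Z] (p : Z → ℝ) (hp : ∀ z, 0 ≤ p z) (f : Z → ℝ) :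
    (∑ z, p z * f z) ^ 2 ≤ (∑ z, p z) * ∑ z, p z * f z ^ 2 :=
  Finset.sum_sq_le_sum_mul_sum_of_sq_le_mul univ (fun z _ => hp z)
    (fun z _ => mul_nonneg (hp z) (sq_nonneg _)) (fun z _ => le_of_eq (by ring))

/-- cut norm versus four-cycle count -/
theorem cut_c4 {X Y : Type} [Fintype X] [Fintype Y] (p : X → ℝ) (q : Y → ℝ)
    (hp : ∀ x, 0 ≤ p x) (hq : ∀ y, 0 ≤ q y) (f : X → Y → ℝ) (u : X → ℝ) (v : Y → ℝ)
    (hu : ∀ x, 0 ≤ u x ∧ u x ≤ 1) (hv : ∀ y, 0 ≤ v y ∧ v y ≤ 1) :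
    (∑ x, ∑ y, p x * q y * (u x * v y * f x y)) ^ 4 ≤
      ((∑ x, p x) * (∑ y, q y)) ^ 2 *
      ∑ x', ∑ y', p x' * q y' * (f x' y' *
        ∑ x, ∑ y, p x * q y * (f x y' * f x' y * f x y)) := by
  set a := ∑ x, p x
  set b := ∑ y, q y
  have ha : 0 ≤ a := Finset.sum_nonneg fun x _ => hp x
  have hb : 0 ≤ b := Finset.sum_nonneg fun x _ => hq x
  -- first Cauchy-Schwarz
  have s1 : (∑ x, ∑ y, p x * q y * (u x * v y * f x y)) ^ 2 ≤
      a * ∑ x, p x * (∑ y, q y * (v y * f x y)) ^ 2 := by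
    have e : ∑ x, ∑ y, p x * q y * (u x * v y * f x y) =
        ∑ x, p x * (u x * ∑ y, q y * (v y * f x y)) := by
      refine Finset.sum_congr rfl fun x _ => ?_
      rw [Finset.mul_sum, Finset.mul_sum]
      exact Finset.sum_congr rfl fun y _ => by ring
    rw [e]
    refine (wcs p hp _).trans (mul_le_mul_of_nonneg_left (Finset.sum_le_sum fun x _ => ?_) ha)
    refine mul_le_mul_of_nonneg_left ?_ (hp x)
    rw [mul_pow]
    exact mul_le_of_le_one_left (sq_nonneg _) (pow_le_one₀ (hu x).1 (hu x).2)
  have s2 : ∑ x, p x * (∑ y, q y * (v y * f x y)) ^ 2 =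
      ∑ z : Y × Y, q z.1 * q z.2 * (v z.1 * v z.2 * ∑ x, p x * (f x z.1 * f x z.2)) := by
    rw [Fintype.sum_prod_type]
    simp only [sq, Finset.sum_mul_sum]
    simp only [Finset.mul_sum]
    rw [Finset.sum_comm]
    refine Finset.sum_congr rfl fun y _ => ?_
    rw [Finset.sum_comm]
    refine Finset.sum_congr rfl fun y' _ => ?_
    exact Finset.sum_congr rfl fun x _ => by ring
  have hbb : ∑ z : Y × Y, q z.1 * q z.2 = b ^ 2 := by
    rw [Fintype.sum_prod_type, sq, Finset.sum_mul_sum]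
  have s3 : (∑ x, p x * (∑ y, q y * (v y * f x y)) ^ 2) ^ 2 ≤
      b ^ 2 * ∑ z : Y × Y, q z.1 * q z.2 * (∑ x, p x * (f x z.1 * f x z.2)) ^ 2 := by
    rw [s2]
    refine (wcs (fun z : Y × Y => q z.1 * q z.2) (fun z => mul_nonneg (hq _) (hq _)) _).trans ?_
    rw [hbb]
    refine mul_le_mul_of_nonneg_left (Finset.sum_le_sum fun z _ => ?_) (sq_nonneg b)
    refine mul_le_mul_of_nonneg_left ?_ (mul_nonneg (hq _) (hq _))
    rw [mul_pow]
    refine mul_le_of_le_one_left (sq_nonneg _) (pow_le_one₀ ?_ ?_)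
    · exact mul_nonneg (hv _).1 (hv _).1
    · exact mul_le_one₀ (hv _).2 (hv _).1 (hv _).2
  have s4 : ∑ z : Y × Y, q z.1 * q z.2 * (∑ x, p x * (f x z.1 * f x z.2)) ^ 2 =
      ∑ x', ∑ y', p x' * q y' * (f x' y' *
        ∑ x, ∑ y, p x * q y * (f x y' * f x' y * f x y)) := by
    rw [Fintype.sum_prod_type]
    simp only [sq, Finset.sum_mul_sum]
    simp only [Finset.mul_sum]
    rw [Finset.sum_comm]
    -- sum over y', y, x, x'
    have : ∀ y' : Y, (∑ y, ∑ x', ∑ x, q y * q y' * (p x' * (f x' y * f x' y') *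
        (p x * (f x y * f x y')))) =
        ∑ x', ∑ x, ∑ y, p x' * q y' * (f x' y' * (p x * q y * (f x y' * f x' y * f x y))) := by
      intro y'
      rw [Finset.sum_comm]
      refine Finset.sum_congr rfl fun x' _ => ?_
      rw [Finset.sum_comm]
      refine Finset.sum_congr rfl fun x _ => ?_
      exact Finset.sum_congr rfl fun y _ => by ring
    simp only [this]
    rw [Finset.sum_comm]
  have hnn : 0 ≤ ∑ x, p x * (∑ y, q y * (v y * f x y)) ^ 2 :=
    Finset.sum_nonneg fun x _ => mul_nonneg (hp x) (sq_nonneg _)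
  rw [← s4]
  calc (∑ x, ∑ y, p x * q y * (u x * v y * f x y)) ^ 4
      = ((∑ x, ∑ y, p x * q y * (u x * v y * f x y)) ^ 2) ^ 2 := by ring
    _ ≤ (a * ∑ x, p x * (∑ y, q y * (v y * f x y)) ^ 2) ^ 2 :=
        pow_le_pow_left₀ (sq_nonneg _) s1 2
    _ = a ^ 2 * (∑ x, p x * (∑ y, q y * (v y * f x y)) ^ 2) ^ 2 := by ring
    _ ≤ a ^ 2 * (b ^ 2 * ∑ z : Y × Y, q z.1 * q z.2 * (∑ x, p x * (f x z.1 * f x z.2)) ^ 2) :=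
        mul_le_mul_of_nonneg_left s3 (sq_nonneg a)
    _ = _ := by ring
/-! ## Expectations over partitionwise maps -/

section EPhisec
variable {r : ℕ} (Ω : Fin r → Type) [∀ i, Fintype (Ω i)] (w : ∀ i, Ω i → ℝ)

theorem EPhi_eq_EP (h : ℕ) (f : PMap Ω h → ℝ) :
    EPhi Ω w h f = EP (X := fun p : Fin r × Fin h => Ω p.1) (fun p => w p.1)
      (fun φ => f (fun i a => φ (i, a))) := by
  unfold EPhi EP
  refine Finset.sum_nbij' (fun φ p => φ p.1 p.2) (fun φ i a => φ (i, a))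
    (by simp) (by simp) (by simp) (by simp) ?_
  intro φ _
  congr 1
  rw [pmapWeight, Fintype.prod_prod_type]

theorem EPhi_mono (hw : ∀ i x, 0 ≤ w i x) {h : ℕ} {F F' : PMap Ω h → ℝ} (hF : ∀ φ, F φ ≤ F' φ) :
    EPhi Ω w h F ≤ EPhi Ω w h F' := by
  rw [EPhi_eq_EP, EPhi_eq_EP]
  exact EP_mono _ (fun _ _ => hw _ _) fun φ => hF _

theorem EPhi_smul {h : ℕ} (a : ℝ) (F : PMap Ω h → ℝ) :
    EPhi Ω w h (fun φ => a * F φ) = a * EPhi Ω w h F := by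
  rw [EPhi_eq_EP, EPhi_eq_EP, EP_smul]

theorem EPhi_add {h : ℕ} (F F' : PMap Ω h → ℝ) :
    EPhi Ω w h (fun φ => F φ + F' φ) = EPhi Ω w h F + EPhi Ω w h F' := by
  rw [EPhi_eq_EP, EPhi_eq_EP, EPhi_eq_EP, EP_add]

theorem EPhi_const (hs : ∀ i, ∑ x, w i x = 1) {h : ℕ} (a : ℝ) :
    EPhi Ω w h (fun _ => a) = a := by
  rw [EPhi_eq_EP, EP_const]
  exact fun p => hs p.1

theorem EPhi_sum {T : Type} (s : Finset T) {h : ℕ} (F : T → PMap Ω h → ℝ) :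
    EPhi Ω w h (fun φ => ∑ t ∈ s, F t φ) = ∑ t ∈ s, EPhi Ω w h (F t) := by
  simp only [EPhi, Finset.mul_sum]
  rw [Finset.sum_comm]

theorem EPhi_nonneg (hw : ∀ i x, 0 ≤ w i x) {h : ℕ} {F : PMap Ω h → ℝ} (hF : ∀ φ, 0 ≤ F φ) :
    0 ≤ EPhi Ω w h F :=
  Finset.sum_nonneg fun φ _ => mul_nonneg
    (Finset.prod_nonneg fun i _ => Finset.prod_nonneg fun a _ => hw _ _) (hF φ)

variable {Ω}

/-- juxtaposition of two samples -/
def papp {a b : ℕ} (φ : PMap Ω a) (ψ : PMap Ω b) : PMap Ω (a + b) :=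
  fun i => Fin.append (φ i) (ψ i)

variable (Ω)

theorem EPhi_papp {a b : ℕ} (F : PMap Ω (a + b) → ℝ) :
    EPhi Ω w (a + b) F = EPhi Ω w a (fun φ => EPhi Ω w b (fun ψ => F (papp φ ψ))) := by
  have h1 : EPhi Ω w a (fun φ => EPhi Ω w b (fun ψ => F (papp φ ψ))) =
      ∑ z : PMap Ω a × PMap Ω b, pmapWeight Ω w z.1 * pmapWeight Ω w z.2 * F (papp z.1 z.2) := by
    rw [Fintype.sum_prod_type]
    simp only [EPhi, Finset.mul_sum, mul_assoc]
  rw [h1]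
  symm
  unfold EPhi
  refine Finset.sum_nbij' (fun z => papp z.1 z.2)
    (fun φ => (fun i k => φ i (Fin.castAdd b k), fun i k => φ i (Fin.natAdd a k)))
    (by simp) (by simp) ?_ ?_ ?_
  · rintro ⟨φ, ψ⟩ _
    simp [papp]
  · intro φ _
    funext i
    simp [papp, Fin.append_castAdd_natAdd]
  · rintro ⟨φ, ψ⟩ _
    congr 1
    simp only [pmapWeight, papp, Fin.prod_univ_add, Fin.append_left, Fin.append_right,
      Finset.prod_mul_distrib]

theorem EPhi_marg2 (hs : ∀ i, ∑ x, w i x = 1) {i j : Fin r} (hij : i ≠ j) (F : Ω i → Ω j → ℝ) :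
    EPhi Ω w 1 (fun ψ => F (ψ i 0) (ψ j 0)) = ∑ x, ∑ y, w i x * w j y * F x y := by
  rw [EPhi_eq_EP]
  exact EP_marg2 (X := fun p : Fin r × Fin 1 => Ω p.1) (fun p => w p.1) (fun p => hs p.1)
    (p := (i, 0)) (p' := (j, 0)) (fun h => hij (congrArg Prod.fst h)) F

theorem geom_half (p : ℝ) (hp0 : 0 ≤ p) (hp1 : p ≤ 1) (N : ℕ) (hN : 1 ≤ N * p) :
    (1 - p) ^ N ≤ 1 / 2 := by
  have h1 : 1 + (N : ℝ) * p ≤ (1 + p) ^ N := one_add_mul_le_pow (by linarith) N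
  have h2 : (1 - p) ^ N * (1 + p) ^ N ≤ 1 := by
    rw [← mul_pow]
    exact pow_le_one₀ (by nlinarith) (by nlinarith)
  have h3 : 0 ≤ (1 - p) ^ N := pow_nonneg (by linarith) N
  nlinarith

/-- first-success lemma -/
theorem first_hit (hw : ∀ i x, 0 ≤ w i x) (hs : ∀ i, ∑ x, w i x = 1)
    (V : ∀ n, PMap Ω n → ℝ) (hV0 : ∀ n φ, 0 ≤ V n φ)
    (hV1 : ∀ n (φ : PMap Ω n) (ψ : PMap Ω 1), V n φ ≤ V (n + 1) (papp φ ψ))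
    (hV2 : ∀ n (φ : PMap Ω n) (ψ : PMap Ω 1), V 1 ψ ≤ V (n + 1) (papp φ ψ))
    (R : PMap Ω 1 → ℝ) (hR : ∀ ψ, 0 ≤ R ψ ∧ R ψ ≤ 1) (N : ℕ)
    (hN : 1 ≤ N * EPhi Ω w 1 R) :
    EPhi Ω w 1 (fun ψ => R ψ * V 1 ψ) ≤ 2 * EPhi Ω w 1 R * EPhi Ω w N (V N) := by
  set p := EPhi Ω w 1 R with hp
  set x := EPhi Ω w 1 (fun ψ => R ψ * V 1 ψ) with hx
  have hp0 : 0 ≤ p := EPhi_nonneg Ω w hw fun ψ => (hR ψ).1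
  have hp1 : p ≤ 1 := by
    rw [← EPhi_const Ω w hs (h := 1) 1]
    exact EPhi_mono Ω w hw fun ψ => (hR ψ).2
  have hx0 : 0 ≤ x := EPhi_nonneg Ω w hw fun ψ => mul_nonneg (hR ψ).1 (hV0 _ _)
  have rec1 : ∀ n, x + (1 - p) * EPhi Ω w n (V n) ≤ EPhi Ω w (n + 1) (V (n + 1)) := by
    intro n
    rw [EPhi_papp]
    have e1 : x + (1 - p) * EPhi Ω w n (V n) =
        EPhi Ω w n (fun φ => EPhi Ω w 1 (fun ψ => R ψ * V 1 ψ + (V n φ + (-(V n φ)) * R ψ))) := by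
      simp only [EPhi_add, EPhi_smul, EPhi_const Ω w hs, ← hp, ← hx]
      have : EPhi Ω w n (fun φ => -V n φ * p) = -p * EPhi Ω w n (V n) := by
        rw [← EPhi_smul]
        congr 1
        funext φ
        ring
      rw [this]; ring
    rw [e1]
    refine EPhi_mono Ω w hw fun φ => EPhi_mono Ω w hw fun ψ => ?_
    have a1 := hV1 n φ ψ
    have a2 := hV2 n φ ψ
    have a3 := hR ψ
    nlinarith [mul_le_mul_of_nonneg_left a2 a3.1,
      mul_le_mul_of_nonneg_left a1 (sub_nonneg.2 a3.2)]
  have ind : ∀ n, x * (1 - (1 - p) ^ n) ≤ p * EPhi Ω w n (V n) := by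
    intro n
    induction n with
    | zero =>
      simp only [pow_zero, sub_self, mul_zero]
      exact mul_nonneg hp0 (EPhi_nonneg Ω w hw fun φ => hV0 _ _)
    | succ n ih =>
      have h1 := mul_le_mul_of_nonneg_left (rec1 n) hp0
      have h2 := mul_le_mul_of_nonneg_left ih (sub_nonneg.2 hp1)
      have e : x * (1 - (1 - p) ^ (n + 1)) = p * x + (1 - p) * (x * (1 - (1 - p) ^ n)) := by ring
      rw [e]
      nlinarith
  have h1 := ind N
  have h2 := geom_half p hp0 hp1 N hN
  nlinarith

end EPhisec

/-! ## Frames of regularizations -/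

section frames
variable {r : ℕ} {Ω : Fin r → Type} [∀ i, Fintype (Ω i)] (w : ∀ i, Ω i → ℝ)
  {K₁ K₂ : Type} [Fintype K₁] [Fintype K₂] (G : CGraph Ω K₁ K₂)

theorem col_iff {m : ℕ} (φ : PMap Ω m) (i : Fin r) (x x' : Ω i) :
    (regz Ω G φ).vCol i x = (regz Ω G φ).vCol i x' ↔
      G.vCol i x = G.vCol i x' ∧ ∀ j, j ≠ i → ∀ b, G.eCol i j x (φ j b) = G.eCol i j x' (φ j b) := by
  simp only [regz, Prod.mk.injEq, funext_iff]
  refine and_congr_right fun _ => forall_congr' fun j => ?_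
  by_cases hj : j = i
  · simp [hj]
  · simp [hj]

theorem col_papp {m n : ℕ} (φ : PMap Ω m) (ψ : PMap Ω n) (i : Fin r) (x x' : Ω i) :
    (regz Ω G (papp φ ψ)).vCol i x = (regz Ω G (papp φ ψ)).vCol i x' ↔
      (regz Ω G φ).vCol i x = (regz Ω G φ).vCol i x' ∧
      (regz Ω G ψ).vCol i x = (regz Ω G ψ).vCol i x' := by
  simp only [col_iff]
  constructor
  · rintro ⟨h1, h2⟩
    refine ⟨⟨h1, fun j hj b => ?_⟩, ⟨h1, fun j hj b => ?_⟩⟩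
    · have := h2 j hj (Fin.castAdd n b)
      simpa only [papp, Fin.append_left] using this
    · have := h2 j hj (Fin.natAdd m b)
      simpa only [papp, Fin.append_right] using this
  · rintro ⟨⟨h1, h2⟩, ⟨_, h3⟩⟩
    refine ⟨h1, fun j hj b => ?_⟩
    refine Fin.addCases (fun b => ?_) (fun b => ?_) b
    · simpa only [papp, Fin.append_left] using h2 j hj b
    · simpa only [papp, Fin.append_right] using h3 j hj b

/-- the frame color of a pair -/
noncomputable def fr {m : ℕ} (φ : PMap Ω m) (i j : Fin r) (z : Ω i × Ω j) :
    (K₁ × (Fin r → Fin m → Option K₂)) × (K₁ × (Fin r → Fin m → Option K₂)) :=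
  ((regz Ω G φ).vCol i z.1, (regz Ω G φ).vCol j z.2)

/-- product weight of a pair -/
def mu (i j : Fin r) (z : Ω i × Ω j) : ℝ := w i z.1 * w j z.2

/-- indicator of an edge color -/
noncomputable def ind (i j : Fin r) (c₂ : K₂) (z : Ω i × Ω j) : ℝ :=
  if G.eCol i j z.1 z.2 = c₂ then 1 else 0

theorem fr_papp {m n : ℕ} (φ : PMap Ω m) (ψ : PMap Ω n) (i j : Fin r) (z z' : Ω i × Ω j) :
    fr G (papp φ ψ) i j z = fr G (papp φ ψ) i j z' ↔
      fr G φ i j z = fr G φ i j z' ∧ fr G ψ i j z = fr G ψ i j z' := by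
  simp only [fr, Prod.mk.injEq, col_papp]
  tauto

/-- squared deviation of the refined densities -/
noncomputable def dev {m n : ℕ} (φ : PMap Ω m) (ψ : PMap Ω n) (i j : Fin r) (c₂ : K₂)
    (z : Ω i × Ω j) : ℝ :=
  (ce (mu w i j) (fr G (papp φ ψ) i j) (ind G i j c₂) (fr G (papp φ ψ) i j z) -
    ce (mu w i j) (fr G φ i j) (ind G i j c₂) (fr G φ i j z)) ^ 2

theorem mu_nonneg (hw : ∀ i x, 0 ≤ w i x) (i j : Fin r) (z : Ω i × Ω j) : 0 ≤ mu w i j z :=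
  mul_nonneg (hw _ _) (hw _ _)

theorem ind_bd (i j : Fin r) (c₂ : K₂) (z : Ω i × Ω j) :
    0 ≤ ind G i j c₂ z ∧ ind G i j c₂ z ≤ 1 := by
  unfold ind
  split_ifs <;> norm_num

theorem cut_bound (hw : ∀ i x, 0 ≤ w i x) (hs : ∀ i, ∑ x, w i x = 1)
    {m : ℕ} (φ : PMap Ω m) {i j : Fin r} (hij : i ≠ j) (c₂ : K₂)
    (ci cj : K₁ × (Fin r → Fin m → Option K₂)) (N : ℕ) (p θ : ℝ)
    (hp : p = (∑ x, w i x * ei ((regz Ω G φ).vCol i x) ci) *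
      (∑ y, w j y * ei ((regz Ω G φ).vCol j y) cj))
    (hN : 1 ≤ N * p)
    (hη : EPhi Ω w N (fun ψ => ∑ z, mu w i j z *
      (ei (fr G φ i j z) (ci, cj) * dev w G φ ψ i j c₂ z)) ≤ θ * p)
    (u : Ω i → ℝ) (v : Ω j → ℝ) (hu : ∀ x, 0 ≤ u x ∧ u x ≤ 1) (hv : ∀ y, 0 ≤ v y ∧ v y ≤ 1) :
    (∑ x, ∑ y, w i x * w j y *
      (ei ((regz Ω G φ).vCol i x) ci *
        ei ((regz Ω G φ).vCol j y) cj *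
        (u x * v y * (ind G i j c₂ (x, y) -
          ce (mu w i j) (fr G φ i j) (ind G i j c₂) (ci, cj))))) ^ 8 ≤ 2 * θ * p ^ 8 := by
  set d := ce (mu w i j) (fr G φ i j) (ind G i j c₂) (ci, cj) with hd
  have hμ := mu_nonneg w hw i j
  have hd0 : 0 ≤ d := ce_nonneg _ hμ _ _ (fun z => (ind_bd G i j c₂ z).1) _
  have hd1 : d ≤ 1 := ce_le_one _ hμ _ _ (fun z => (ind_bd G i j c₂ z).2) _
  let gi : Ω i → ℝ := fun x => ei ((regz Ω G φ).vCol i x) ci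
  let gj : Ω j → ℝ := fun y => ei ((regz Ω G φ).vCol j y) cj
  have hgi : ∀ x, 0 ≤ gi x ∧ gi x ≤ 1 := fun x => ei_bd _ _
  have hgj : ∀ x, 0 ≤ gj x ∧ gj x ≤ 1 := fun x => ei_bd _ _
  have hgij : ∀ z : Ω i × Ω j, ei (fr G φ i j z) (ci, cj) =
      gi z.1 * gj z.2 := by
    intro z
    simp only [gi, gj, fr, ei, Prod.mk.injEq]
    by_cases h1 : (regz Ω G φ).vCol i z.1 = ci <;> by_cases h2 : (regz Ω G φ).vCol j z.2 = cj <;>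
      simp [h1, h2]
  let pp : Ω i → ℝ := fun x => w i x * gi x
  let qq : Ω j → ℝ := fun y => w j y * gj y
  have hpp : ∀ x, 0 ≤ pp x := fun x => mul_nonneg (hw _ _) (hgi x).1
  have hqq : ∀ x, 0 ≤ qq x := fun x => mul_nonneg (hw _ _) (hgj x).1
  have hp' : p = (∑ x, pp x) * ∑ y, qq y := hp
  let ff : Ω i → Ω j → ℝ := fun x y => ind G i j c₂ (x, y) - d
  have hff : ∀ x y, |ff x y| ≤ 1 := by
    intro x y
    have := ind_bd G i j c₂ (x, y)
    rw [abs_le]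
    constructor <;> simp only [ff] <;> linarith
  let V : ∀ n, PMap Ω n → ℝ := fun n ψ => ∑ z, mu w i j z *
      (ei (fr G φ i j z) (ci, cj) * dev w G φ ψ i j c₂ z)
  let inner : Ω i → Ω j → ℝ := fun x' y' =>
    ∑ x, ∑ y, pp x * qq y * (ff x y' * ff x' y * ff x y)
  let C4 : ℝ := ∑ x', ∑ y', pp x' * qq y' * (ff x' y' * inner x' y')
  have hp0 : 0 ≤ p := hp' ▸ mul_nonneg (Finset.sum_nonneg fun x _ => hpp x)
    (Finset.sum_nonneg fun x _ => hqq x)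
  have hpz : p = ∑ z : Ω i × Ω j, pp z.1 * qq z.2 := by
    rw [hp', Finset.sum_mul_sum, Fintype.sum_prod_type]
  have hpz' : p = ∑ z : Ω i × Ω j, mu w i j z * ei (fr G φ i j z) (ci, cj) := by
    rw [hpz]
    refine Finset.sum_congr rfl fun z _ => ?_
    rw [hgij]
    simp only [pp, qq, mu]
    ring
  -- first step
  have s1 : (∑ x, ∑ y, w i x * w j y *
      (ei ((regz Ω G φ).vCol i x) ci *
        ei ((regz Ω G φ).vCol j y) cj *
        (u x * v y * (ind G i j c₂ (x, y) - d)))) ^ 4 ≤ p ^ 2 * C4 := by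
    have := cut_c4 pp qq hpp hqq ff u v hu hv
    rw [← hp'] at this
    refine le_trans (le_of_eq ?_) this
    congr 1
    refine Finset.sum_congr rfl fun x _ => Finset.sum_congr rfl fun y _ => ?_
    simp only [pp, qq, gi, gj, ff]
    ring
  -- inner bound
  have s2 : ∀ ψ : PMap Ω 1, inner (ψ i 0) (ψ j 0) ^ 2 ≤ p * V 1 ψ := by
    intro ψ
    have := ce_corr (mu w i j) hμ (fr G φ i j) (fr G (papp φ ψ) i j)
      (fun z z' h => ((fr_papp G φ ψ i j z z').1 h).1) (ci, cj) (ind G i j c₂)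
      (fun z => ff z.1 (ψ j 0) * ff (ψ i 0) z.2) ?_ ?_
    · rw [← hpz'] at this
      refine le_trans (le_of_eq ?_) this
      congr 1
      rw [Fintype.sum_prod_type]
      refine Finset.sum_congr rfl fun x _ => Finset.sum_congr rfl fun y _ => ?_
      rw [hgij]
      simp only [pp, qq, mu, ff, ← hd]
      ring
    · intro z z' h
      have h2 := ((fr_papp G φ ψ i j z z').1 h).2
      simp only [fr, Prod.mk.injEq, col_iff] at h2
      have a1 := h2.1.2 j hij.symm 0
      have a2 := h2.2.2 i hij 0
      simp only [ff, ind]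
      rw [a1, G.eSymm i j (ψ i 0) z.2, G.eSymm i j (ψ i 0) z'.2, a2]
    · intro z
      rw [abs_mul]
      exact mul_le_one₀ (hff _ _) (abs_nonneg _) (hff _ _)
  let R : PMap Ω 1 → ℝ := fun ψ => gi (ψ i 0) * gj (ψ j 0)
  have hR : ∀ ψ, 0 ≤ R ψ ∧ R ψ ≤ 1 := fun ψ =>
    ⟨mul_nonneg (hgi _).1 (hgj _).1, mul_le_one₀ (hgi _).2 (hgj _).1 (hgj _).2⟩
  have hER : EPhi Ω w 1 R = p := by
    have := EPhi_marg2 Ω w hs hij (fun x y => gi x * gj y)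
    refine this.trans ?_
    rw [hpz, Fintype.sum_prod_type]
    refine Finset.sum_congr rfl fun x _ => Finset.sum_congr rfl fun y _ => ?_
    simp only [pp, qq]; ring
  have hV0 : ∀ n ψ, 0 ≤ V n ψ := fun n ψ => Finset.sum_nonneg fun z _ =>
    mul_nonneg (hμ z) (mul_nonneg (ei_bd _ _).1 (sq_nonneg _))
  have hit := first_hit Ω w hw hs V hV0 (fun n φ' ψ => by
      refine ce_mono (mu w i j) hμ (fr G φ i j) (fr G (papp φ φ') i j)
        (fr G (papp φ (papp φ' ψ)) i j) ?_ ?_ _ _ ?_ ?_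
      · intro z z' h; simp only [fr_papp] at h; exact h.1
      · intro z z' h; simp only [fr_papp] at h ⊢; tauto
      · intro z; exact (ei_bd _ _).1
      · intro z z' h; rw [h]) (fun n φ' ψ => by
      refine ce_mono (mu w i j) hμ (fr G φ i j) (fr G (papp φ ψ) i j)
        (fr G (papp φ (papp φ' ψ)) i j) ?_ ?_ _ _ ?_ ?_
      · intro z z' h; simp only [fr_papp] at h; exact h.1
      · intro z z' h; simp only [fr_papp] at h ⊢; tauto
      · intro z; exact (ei_bd _ _).1
      · intro z z' h; rw [h]) R hR N (by rw [hER]; exact hN)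
  rw [hER] at hit
  -- C4 bound
  have s3 : C4 ^ 2 ≤ p * ∑ x', ∑ y', pp x' * qq y' * inner x' y' ^ 2 := by
    have := wcs (fun z : Ω i × Ω j => pp z.1 * qq z.2) (fun z => mul_nonneg (hpp _) (hqq _))
      (fun z => ff z.1 z.2 * inner z.1 z.2)
    rw [← hpz] at this
    simp only [Fintype.sum_prod_type] at this
    refine this.trans (mul_le_mul_of_nonneg_left (Finset.sum_le_sum fun x _ =>
      Finset.sum_le_sum fun y _ => mul_le_mul_of_nonneg_left ?_ (mul_nonneg (hpp _) (hqq _))) hp0)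
    rw [mul_pow]
    refine mul_le_of_le_one_left (sq_nonneg _) ?_
    rw [← sq_abs]
    exact pow_le_one₀ (abs_nonneg _) (hff _ _)
  have s4 : ∑ x', ∑ y', pp x' * qq y' * inner x' y' ^ 2 ≤
      p * EPhi Ω w 1 (fun ψ => R ψ * V 1 ψ) := by
    have := EPhi_marg2 Ω w hs hij (fun x y => gi x * gj y * inner x y ^ 2)
    have e : ∑ x', ∑ y', pp x' * qq y' * inner x' y' ^ 2 =
        ∑ x, ∑ y, w i x * w j y * (gi x * gj y * inner x y ^ 2) := by
      refine Finset.sum_congr rfl fun x _ => Finset.sum_congr rfl fun y _ => ?_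
      simp only [pp, qq]; ring
    rw [e, ← this, ← EPhi_smul]
    refine EPhi_mono Ω w hw fun ψ => ?_
    have h1 := mul_le_mul_of_nonneg_left (s2 ψ) (hR ψ).1
    refine h1.trans (le_of_eq ?_)
    ring
  have s5 : EPhi Ω w 1 (fun ψ => R ψ * V 1 ψ) ≤ 2 * p * (θ * p) :=
    hit.trans (mul_le_mul_of_nonneg_left hη (by linarith))
  have s6 : C4 ^ 2 ≤ 2 * θ * p ^ 4 := by
    calc C4 ^ 2 ≤ p * ∑ x', ∑ y', pp x' * qq y' * inner x' y' ^ 2 := s3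
      _ ≤ p * (p * (2 * p * (θ * p))) := mul_le_mul_of_nonneg_left
          (s4.trans (mul_le_mul_of_nonneg_left s5 hp0)) hp0
      _ = _ := by ring
  set A := (∑ x, ∑ y, w i x * w j y *
      (ei ((regz Ω G φ).vCol i x) ci *
        ei ((regz Ω G φ).vCol j y) cj *
        (u x * v y * (ind G i j c₂ (x, y) - d))))
  have hA4 : 0 ≤ A ^ 4 := by positivity
  calc A ^ 8 = (A ^ 4) ^ 2 := by ring
    _ ≤ (p ^ 2 * C4) ^ 2 := pow_le_pow_left₀ hA4 s1 2
    _ = p ^ 4 * C4 ^ 2 := by ring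
    _ ≤ p ^ 4 * (2 * θ * p ^ 4) := mul_le_mul_of_nonneg_left s6 (by positivity)
    _ = _ := by ring

end frames
/-! ## From cut bounds to the counting equation -/

theorem prod_up {Q : Type} (F : Finset Q) (d : Q → ℝ) (d0 δ0 κ : ℝ) (n : ℕ)
    (hd0 : 0 < d0) (hd01 : d0 ≤ 1) (hδ0 : 0 ≤ δ0) (hd : ∀ q ∈ F, d0 ≤ d q)
    (hn : F.card ≤ n) (hκ : F.card * κ ≤ δ0 * d0 ^ n) :
    ∏ q ∈ F, d q + F.card * κ ≤ ∏ q ∈ F, (d q + δ0) := by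
  rcases F.eq_empty_or_nonempty with rfl | ⟨q, hq⟩
  · simp
  · have hge : d0 ^ n ≤ ∏ q' ∈ F.erase q, d q' := by
      calc d0 ^ n ≤ d0 ^ (F.erase q).card :=
            pow_le_pow_of_le_one hd0.le hd01 ((Finset.card_erase_le).trans hn)
        _ = ∏ _q' ∈ F.erase q, d0 := by rw [Finset.prod_const]
        _ ≤ _ := Finset.prod_le_prod (fun _ _ => hd0.le)
            fun q' hq' => hd q' (Finset.mem_of_mem_erase hq')
    have hle : ∏ q' ∈ F.erase q, d q' ≤ ∏ q' ∈ F.erase q, (d q' + δ0) :=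
      Finset.prod_le_prod (fun q' hq' => hd0.le.trans (hd q' (Finset.mem_of_mem_erase hq')))
        fun q' _ => by linarith
    rw [← Finset.mul_prod_erase F d hq, ← Finset.mul_prod_erase F (fun q => d q + δ0) hq]
    have h1 : (d q + δ0) * ∏ q' ∈ F.erase q, d q' ≤
        (d q + δ0) * ∏ q' ∈ F.erase q, (d q' + δ0) :=
      mul_le_mul_of_nonneg_left hle (by linarith [hd q hq])
    have h2 := mul_le_mul_of_nonneg_left hge hδ0
    nlinarith

theorem prod_down {Q : Type} (F : Finset Q) (d : Q → ℝ) (d0 δ0 κ : ℝ) (n : ℕ)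
    (hd0 : 0 < d0) (hd01 : d0 ≤ 1) (hδ0 : 0 ≤ δ0) (hd : ∀ q ∈ F, d0 ≤ d q)
    (hn : F.card ≤ n) (hκ : F.card * κ ≤ δ0 * d0 ^ n) :
    ∏ q ∈ F, max 0 (d q - δ0) ≤ max 0 (∏ q ∈ F, d q - F.card * κ) := by
  rcases F.eq_empty_or_nonempty with rfl | ⟨q, hq⟩
  · simp
  · have hge : d0 ^ n ≤ ∏ q' ∈ F.erase q, d q' := by
      calc d0 ^ n ≤ d0 ^ (F.erase q).card :=
            pow_le_pow_of_le_one hd0.le hd01 ((Finset.card_erase_le).trans hn)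
        _ = ∏ _q' ∈ F.erase q, d0 := by rw [Finset.prod_const]
        _ ≤ _ := Finset.prod_le_prod (fun _ _ => hd0.le)
            fun q' hq' => hd q' (Finset.mem_of_mem_erase hq')
    have hpos : 0 ≤ ∏ q' ∈ F.erase q, d q' := (pow_nonneg hd0.le n).trans hge
    have hle : ∏ q' ∈ F.erase q, max 0 (d q' - δ0) ≤ ∏ q' ∈ F.erase q, d q' :=
      Finset.prod_le_prod (fun q' hq' => le_max_left _ _)
        fun q' hq' => max_le (hd0.le.trans (hd q' (Finset.mem_of_mem_erase hq'))) (by linarith)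
    rw [← Finset.mul_prod_erase F d hq, ← Finset.mul_prod_erase F (fun q => max 0 (d q - δ0)) hq]
    have h1 : max 0 (d q - δ0) * ∏ q' ∈ F.erase q, max 0 (d q' - δ0) ≤
        max 0 (d q - δ0) * ∏ q' ∈ F.erase q, d q' :=
      mul_le_mul_of_nonneg_left hle (le_max_left _ _)
    refine h1.trans ?_
    have h2 := mul_le_mul_of_nonneg_left hge hδ0
    rcases le_total (d q - δ0) 0 with h | h
    · rw [max_eq_left h, zero_mul]
      exact le_max_left _ _
    · rw [max_eq_right h]
      refine le_trans ?_ (le_max_right _ _)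
      nlinarith

theorem box_prod {Q : Type} (T : Finset Q) (lo hi : Q → ℝ) (hlh : ∀ q ∈ T, lo q ≤ hi q) (ρ : ℝ)
    (h1 : ∏ q ∈ T, lo q ≤ ρ) (h2 : ρ ≤ ∏ q ∈ T, hi q) :
    ∃ c : Q → ℝ, (∀ q ∈ T, lo q ≤ c q ∧ c q ≤ hi q) ∧ ρ = ∏ q ∈ T, c q := by
  let F : ℝ → ℝ := fun s => ∏ q ∈ T, (lo q + s * (hi q - lo q))
  have hF : Continuous F := by
    refine continuous_finsetProd _ fun q _ => ?_
    fun_prop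
  have := intermediate_value_Icc (zero_le_one' ℝ) hF.continuousOn
  have hm : ρ ∈ Set.Icc (F 0) (F 1) := by
    simp only [F, zero_mul, add_zero, one_mul, add_sub_cancel]
    exact ⟨h1, h2⟩
  obtain ⟨s, ⟨hs0, hs1⟩, hs⟩ := this hm
  refine ⟨fun q => lo q + s * (hi q - lo q), fun q hq => ?_, hs.symm⟩
  have := hlh q hq
  constructor <;> nlinarith

/-- optional indicator -/
noncomputable def oi {K : Type} : Option K → K → ℝ
  | none, _ => 1
  | some c, k => ei k c

theorem oi_bd {K : Type} (o : Option K) (k : K) : 0 ≤ oi o k ∧ oi o k ≤ 1 := by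
  cases o with
  | none => simp [oi]
  | some c => exact ei_bd _ _

section counting
variable {r : ℕ} (Ω : Fin r → Type) [∀ i, Fintype (Ω i)] (w : ∀ i, Ω i → ℝ)
  {K₁ K₂ : Type} (G : CGraph Ω K₁ K₂)

theorem dE_eq_ce (i j : Fin r) (c₂ : K₂) (ci cj : K₁) :
    dE Ω w G i j c₂ ci cj = ce (mu w i j) (fun z => (G.vCol i z.1, G.vCol j z.2))
      (ind G i j c₂) (ci, cj) := by
  unfold dE ce
  simp only [Fintype.sum_prod_type]
  congr 1
  · refine Finset.sum_congr rfl fun x _ => Finset.sum_congr rfl fun y _ => ?_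
    simp only [mu, ind, Prod.mk.injEq]
    by_cases h1 : G.eCol i j x y = c₂ <;> by_cases h2 : G.vCol i x = ci ∧ G.vCol j y = cj <;>
      simp [h1, h2]
  · refine Finset.sum_congr rfl fun x _ => Finset.sum_congr rfl fun y _ => ?_
    simp only [mu, Prod.mk.injEq]

theorem dE_bd (hw : ∀ i x, 0 ≤ w i x) (i j : Fin r) (c₂ : K₂) (ci cj : K₁) :
    0 ≤ dE Ω w G i j c₂ ci cj ∧ dE Ω w G i j c₂ ci cj ≤ 1 := by
  rw [dE_eq_ce]
  have hμ : ∀ z, 0 ≤ mu w i j z := fun z => mul_nonneg (hw _ _) (hw _ _)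
  have hi : ∀ z, 0 ≤ ind G i j c₂ z ∧ ind G i j c₂ z ≤ 1 := fun z => ei_bd _ _
  exact ⟨ce_nonneg _ hμ _ _ (fun z => (hi z).1) _, ce_le_one _ hμ _ _ (fun z => (hi z).2) _⟩

theorem dV_eq (i : Fin r) (c : K₁) : dV Ω w G i c = ∑ x, w i x * ei (G.vCol i x) c := by
  unfold dV ei
  refine Finset.sum_congr rfl fun x _ => ?_
  split_ifs <;> simp

/-- the two-valued error function -/
noncomputable def del (Good : Fin r → Fin r → K₂ → K₁ → K₁ → Prop) (δ0 : ℝ)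
    (i j : Fin r) (c₂ : K₂) (ci cj : K₁) : ℝ :=
  if i < j then (if Good i j c₂ ci cj then δ0 else 1) else 0

theorem isErrorFun_del (hw : ∀ i x, 0 ≤ w i x) (hs : ∀ i, ∑ x, w i x = 1) (h : ℕ)
    (Good : Fin r → Fin r → K₂ → K₁ → K₁ → Prop) (δ0 d0 κ : ℝ) (hδ0 : 0 ≤ δ0)
    (hd0 : 0 < d0) (hd01 : d0 ≤ 1) (hκ0 : 0 ≤ κ)
    (hκ : ((r * (r * (h * h)) : ℕ) : ℝ) * κ ≤ δ0 * d0 ^ (r * (r * (h * h))))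
    (hgd : ∀ i j c₂ ci cj, i < j → Good i j c₂ ci cj → d0 ≤ dE Ω w G i j c₂ ci cj)
    (hgc : ∀ i j c₂ ci cj, i < j → Good i j c₂ ci cj → ∀ (u : Ω i → ℝ) (v : Ω j → ℝ),
      (∀ x, 0 ≤ u x ∧ u x ≤ 1) → (∀ y, 0 ≤ v y ∧ v y ≤ 1) →
      |∑ x, ∑ y, w i x * w j y * (ei (G.vCol i x) ci * ei (G.vCol j y) cj *
        (u x * v y * (ei (G.eCol i j x y) c₂ - dE Ω w G i j c₂ ci cj)))| ≤
        κ * ((∑ x, w i x * ei (G.vCol i x) ci) * (∑ y, w j y * ei (G.vCol j y) cj))) :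
    IsErrorFun Ω w G h (del Good δ0) := by
  intro S _
  set n := r * (r * (h * h)) with hn
  let X : Fin r × Fin h → Type := fun p => Ω p.1
  let W : ∀ p, X p → ℝ := fun p => w p.1
  let g : ∀ p, X p → ℝ := fun p x => oi (S.vCol p.1 p.2) (G.vCol p.1 x)
  let s : Fin r × Fin r × Fin h × Fin h → Fin r × Fin h := fun q => (q.1, q.2.2.1)
  let t : Fin r × Fin r × Fin h × Fin h → Fin r × Fin h := fun q => (q.2.1, q.2.2.2)
  let e : ∀ q, X (s q) → X (t q) → ℝ := fun q x y =>
    oi (S.eCol q.1 q.2.1 q.2.2.1 q.2.2.2) (G.eCol q.1 q.2.1 x y)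
  let d : Fin r × Fin r × Fin h × Fin h → ℝ := dES Ω w G S
  have hd : ∀ q, 0 ≤ d q ∧ d q ≤ 1 := by
    intro q
    simp only [d, dES]
    split
    · exact dE_bd Ω w G hw _ _ _ _ _
    · norm_num
  have hV2 : ∀ q ∈ V2 S, q.1 < q.2.1 ∧ ∃ c₂ ci cj, S.eCol q.1 q.2.1 q.2.2.1 q.2.2.2 = some c₂ ∧
      S.vCol q.1 q.2.2.1 = some ci ∧ S.vCol q.2.1 q.2.2.2 = some cj := by
    intro q hq
    simp only [V2, Finset.mem_filter, Finset.mem_univ, true_and] at hq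
    refine ⟨hq.1, ?_⟩
    obtain ⟨c₂, h2⟩ := Option.ne_none_iff_exists'.1 hq.2
    have hi : S.vCol q.1 q.2.2.1 ≠ none := fun h0 => hq.2 (S.down _ _ _ _ h0)
    have hj : S.vCol q.2.1 q.2.2.2 ≠ none := fun h0 => hq.2 (by
      rw [S.eSymm]; exact S.down _ _ _ _ h0)
    obtain ⟨ci, h3⟩ := Option.ne_none_iff_exists'.1 hi
    obtain ⟨cj, h4⟩ := Option.ne_none_iff_exists'.1 hj
    exact ⟨c₂, ci, cj, h2, h3, h4⟩
  let gq : Fin r × Fin r × Fin h × Fin h → Prop := fun q =>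
    ∃ c₂ ci cj, S.eCol q.1 q.2.1 q.2.2.1 q.2.2.2 = some c₂ ∧
      S.vCol q.1 q.2.2.1 = some ci ∧ S.vCol q.2.1 q.2.2.2 = some cj ∧ Good q.1 q.2.1 c₂ ci cj
  have hδg : ∀ q ∈ V2 S, gq q → deltaS (del Good δ0) S q = δ0 := by
    rintro q hq ⟨c₂, ci, cj, h2, h3, h4, h5⟩
    simp only [deltaS, h2, h3, h4, del, (hV2 q hq).1, h5, if_true]
  have hδb : ∀ q ∈ V2 S, ¬ gq q → deltaS (del Good δ0) S q = 1 := by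
    intro q hq hg
    obtain ⟨h1, c₂, ci, cj, h2, h3, h4⟩ := hV2 q hq
    have h5 : ¬ Good q.1 q.2.1 c₂ ci cj := fun h5 => hg ⟨c₂, ci, cj, h2, h3, h4, h5⟩
    simp only [deltaS, h2, h3, h4, del, h1, h5, if_true, if_false]
  have hdg : ∀ q ∈ V2 S, gq q → d0 ≤ d q := by
    rintro q hq ⟨c₂, ci, cj, h2, h3, h4, h5⟩
    simp only [d, dES, h2, h3, h4]
    exact hgd _ _ _ _ _ (hV2 q hq).1 h5
  let P : ℝ := ∏ p, ∑ x, W p x * g p x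
  have hg0 : ∀ p x, 0 ≤ g p x ∧ g p x ≤ 1 := fun p x => oi_bd _ _
  have hP0 : 0 ≤ P := Finset.prod_nonneg fun p _ => Finset.sum_nonneg fun x _ =>
    mul_nonneg (hw _ _) (hg0 p x).1
  have he : ∀ q x y, 0 ≤ e q x y ∧ e q x y ≤ 1 := fun q x y => oi_bd _ _
  let cnt : Finset (Fin r × Fin r × Fin h × Fin h) → ℝ := fun F =>
    EP W (fun φ => (∏ p, g p (φ p)) * ∏ q ∈ F, e q (φ (s q)) (φ (t q)))
  -- counting bound
  have key : ∀ F ⊆ V2 S, (∀ q ∈ F, gq q) →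
      |cnt F - P * ∏ q ∈ F, d q| ≤ F.card * (κ * P) := by
    intro F hF hFg
    refine count_abs W (fun p => hw p.1) (fun p => hs p.1) g (fun p x => (hg0 p x).1) s t e he
      d hd κ F ?_ ?_ ?_
    · intro q hq h0
      exact (hV2 q (hF hq)).1.ne (congrArg Prod.fst h0)
    · intro q hq q' hq' hne
      have l1 := (hV2 q (hF hq)).1
      have l2 := (hV2 q' (hF hq')).1
      obtain ⟨i, j, a, b⟩ := q
      obtain ⟨i', j', a', b'⟩ := q'
      simp only [s, t, Prod.mk.injEq, ne_eq] at *
      rintro ⟨h1 | h1, h2 | h2⟩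
      · exact l1.ne (h1.1.trans h2.1.symm)
      · exact hne ⟨h1.1, h2.1, h1.2, h2.2⟩
      · rw [h1.1, h2.1] at l1
        exact lt_asymm l1 l2
      · exact l1.ne (h1.1.trans h2.1.symm)
    · intro q hq u v hu hv
      obtain ⟨c₂, ci, cj, h2, h3, h4, h5⟩ := hFg q hq
      have := hgc _ _ _ _ _ (hV2 q (hF hq)).1 h5 u v hu hv
      simpa only [W, g, e, d, s, t, dES, h2, h3, h4, oi] using this
  have hcnt0 : ∀ F, 0 ≤ cnt F := by
    intro F
    have : EP W (fun _ => (0 : ℝ)) ≤ cnt F := EP_mono W (fun p => hw p.1) fun φ =>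
      mul_nonneg (Finset.prod_nonneg fun p _ => (hg0 _ _).1)
        (Finset.prod_nonneg fun q _ => (he _ _ _).1)
    rwa [EP_const W (fun p => hs p.1)] at this
  have hcntmono : ∀ F F', F ⊆ F' → cnt F' ≤ cnt F := by
    intro F F' hFF
    refine EP_mono W (fun p => hw p.1) fun φ => mul_le_mul_of_nonneg_left ?_
      (Finset.prod_nonneg fun p _ => (hg0 _ _).1)
    rw [← Finset.prod_sdiff hFF]
    exact mul_le_of_le_one_left (Finset.prod_nonneg fun q _ => (he _ _ _).1)
      (Finset.prod_le_one (fun q _ => (he _ _ _).1) (fun q _ => (he _ _ _).2))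
  have hcntP : cnt ∅ = P := by
    simp only [cnt, Finset.prod_empty, mul_one]
    exact EP_prod W g
  have hcp : countProb Ω w G S = cnt (V2 S) := by
    unfold countProb
    rw [EPhi_eq_EP]
    refine congrArg (EP W) ?_
    funext φ
    have hv : vEvent G S (fun i a => φ (i, a)) ↔ ∀ p, g p (φ p) = 1 := by
      simp only [vEvent, V1, Finset.mem_filter, Finset.mem_univ, true_and]
      refine forall_congr' fun p => ?_
      simp only [g]
      cases hS : S.vCol p.1 p.2 with
      | none => simp [oi]
      | some c =>
        simp only [oi, ei, Option.some.injEq, ne_eq, reduceCtorEq, not_false_eq_true, true_imp_iff]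
        split_ifs with h1
        · simp only [iff_true]; exact h1
        · simp only [zero_ne_one, iff_false]; exact h1
    have hv0 : ∀ p, ¬ g p (φ p) = 1 → g p (φ p) = 0 := by
      intro p
      simp only [g]
      cases S.vCol p.1 p.2 with
      | none => simp [oi]
      | some c => simp only [oi, ei]; split_ifs <;> simp
    have hE : eEvent G S (fun i a => φ (i, a)) ↔ ∀ q ∈ V2 S, e q (φ (s q)) (φ (t q)) = 1 := by
      simp only [eEvent]
      refine forall_congr' fun q => forall_congr' fun hq => ?_
      obtain ⟨h1, c₂, ci, cj, h2, h3, h4⟩ := hV2 q hq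
      simp only [e, h2, oi, ei, Option.some.injEq, s, t]
      split_ifs with h5
      · simp only [iff_true]; exact h5
      · simp only [zero_ne_one, iff_false]; exact h5
    have hE0 : ∀ q, ¬ e q (φ (s q)) (φ (t q)) = 1 → e q (φ (s q)) (φ (t q)) = 0 := by
      intro q
      simp only [e]
      cases S.eCol q.1 q.2.1 q.2.2.1 q.2.2.2 with
      | none => simp [oi]
      | some c => simp only [oi, ei]; split_ifs <;> simp
    rw [hv, hE]
    split_ifs with hh
    · rw [Finset.prod_eq_one fun p _ => hh.1 p, Finset.prod_eq_one fun q hq => hh.2 q hq, mul_one]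
    · rw [not_and_or] at hh
      rcases hh with hh | hh
      · push Not at hh
        obtain ⟨p, hp⟩ := hh
        rw [Finset.prod_eq_zero (Finset.mem_univ p) (hv0 p hp), zero_mul]
      · push Not at hh
        obtain ⟨q, hq, hq1⟩ := hh
        rw [Finset.prod_eq_zero hq (hE0 q hq1), mul_zero]
  have hPV : (∏ p ∈ V1 S, dVS Ω w G S p) = P := by
    rw [V1, Finset.prod_filter]
    refine Finset.prod_congr rfl fun p _ => ?_
    simp only [dVS, g, W]
    cases S.vCol p.1 p.2 with
    | none => simp [oi, X, hs]
    | some c => simp only [ne_eq, reduceCtorEq, not_false_eq_true, if_true, oi, dV_eq]; rfl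
  have hlohi : ∀ q ∈ V2 S, max 0 (dES Ω w G S q - deltaS (del Good δ0) S q) ≤
      min 1 (dES Ω w G S q + deltaS (del Good δ0) S q) := by
    intro q hq
    have hdq := hd q
    have h0 : 0 ≤ deltaS (del Good δ0) S q := by
      by_cases hg : gq q
      · rw [hδg q hq hg]; exact hδ0
      · rw [hδb q hq hg]; norm_num
    simp only [d] at hdq
    refine max_le (le_min zero_le_one (by linarith)) (le_min (by linarith) (by linarith))
  have hcard : ∀ F : Finset (Fin r × Fin r × Fin h × Fin h), F.card ≤ n := by
    intro F
    refine (Finset.card_le_univ F).trans (le_of_eq ?_)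
    simp [hn]
  have hcκ : ∀ F : Finset (Fin r × Fin r × Fin h × Fin h), F.card * κ ≤ δ0 * d0 ^ n := by
    intro F
    refine le_trans (mul_le_mul_of_nonneg_right ?_ hκ0) hκ
    exact_mod_cast hcard F
  unfold CountEqAt
  rw [hPV, hcp]
  by_cases hP : P = 0
  · have hz : cnt (V2 S) = 0 := le_antisymm
      (by rw [← hP, ← hcntP]; exact hcntmono _ _ (Finset.empty_subset _)) (hcnt0 _)
    exact ⟨fun q => max 0 (dES Ω w G S q - deltaS (del Good δ0) S q),
      fun q hq => ⟨le_rfl, hlohi q hq⟩, by rw [hz, hP, zero_mul]⟩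
  have hPpos : 0 < P := lt_of_le_of_ne hP0 (Ne.symm hP)
  have hlow : ∏ q ∈ V2 S, max 0 (dES Ω w G S q - deltaS (del Good δ0) S q) ≤ cnt (V2 S) / P := by
    by_cases hall : ∀ q ∈ V2 S, gq q
    · have e1 : ∏ q ∈ V2 S, max 0 (dES Ω w G S q - deltaS (del Good δ0) S q) =
          ∏ q ∈ V2 S, max 0 (d q - δ0) :=
        Finset.prod_congr rfl fun q hq => by rw [hδg q hq (hall q hq)]
      rw [e1]
      refine (prod_down (V2 S) d d0 δ0 κ n hd0 hd01 hδ0 (fun q hq => hdg q hq (hall q hq))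
        (hcard _) (hcκ _)).trans ?_
      refine max_le (div_nonneg (hcnt0 _) hP0) ?_
      rw [le_div_iff₀ hPpos]
      have := (abs_le.1 (key (V2 S) (Finset.Subset.refl _) hall)).1
      nlinarith
    · push Not at hall
      obtain ⟨q, hq, hqb⟩ := hall
      rw [Finset.prod_eq_zero hq]
      · exact div_nonneg (hcnt0 _) hP0
      · rw [hδb q hq hqb]
        exact max_eq_left (by linarith [(hd q).2])
  have hup : cnt (V2 S) / P ≤ ∏ q ∈ V2 S, min 1 (dES Ω w G S q + deltaS (del Good δ0) S q) := by
    set F := (V2 S).filter (fun q => gq q ∧ d q + δ0 ≤ 1) with hF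
    have hFs : F ⊆ V2 S := Finset.filter_subset _ _
    have hFg : ∀ q ∈ F, gq q := fun q hq => (Finset.mem_filter.1 hq).2.1
    have e1 : ∏ q ∈ V2 S, min 1 (dES Ω w G S q + deltaS (del Good δ0) S q) =
        ∏ q ∈ F, (d q + δ0) := by
      rw [hF, Finset.prod_filter]
      refine Finset.prod_congr rfl fun q hq => ?_
      by_cases hg : gq q
      · rw [hδg q hq hg]
        by_cases hle : d q + δ0 ≤ 1
        · rw [if_pos ⟨hg, hle⟩]; exact min_eq_right hle
        · rw [if_neg (fun hh => hle hh.2)]; exact min_eq_left (not_le.1 hle).le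
      · rw [hδb q hq hg, if_neg (fun hh => hg hh.1)]
        exact min_eq_left (by linarith [(hd q).1])
    rw [e1]
    refine le_trans ?_ (prod_up F d d0 δ0 κ n hd0 hd01 hδ0
      (fun q hq => hdg q (hFs hq) (hFg q hq)) (hcard _) (hcκ _))
    rw [div_le_iff₀ hPpos]
    have h1 := (abs_le.1 (key F hFs hFg)).2
    have h2 := hcntmono F (V2 S) hFs
    nlinarith
  obtain ⟨c, hc1, hc2⟩ := box_prod (V2 S)
    (fun q => max 0 (dES Ω w G S q - deltaS (del Good δ0) S q))
    (fun q => min 1 (dES Ω w G S q + deltaS (del Good δ0) S q)) hlohi (cnt (V2 S) / P) hlow hup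
  exact ⟨c, hc1, by rw [← hc2]; field_simp⟩

end counting

/-! ## Averaging the error function -/

theorem rare {X C : Type} [Fintype X] (p : X → ℝ) (hp : ∀ x, 0 ≤ p x) (c : X → C) (S : Finset C)
    (hS : ∀ x, c x ∈ S) (B : ℕ) (hB : S.card ≤ B) (hB0 : 1 ≤ B) (τ : ℝ) (hτ : 0 ≤ τ) :
    ∑ x, p x * (if ∑ y, p y * ei (c y) (c x) ≤ τ / B then 1 else 0) ≤ τ := by
  have hB' : (0 : ℝ) < B := by exact_mod_cast hB0
  calc ∑ x, p x * (if ∑ y, p y * ei (c y) (c x) ≤ τ / B then 1 else 0)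
      = ∑ γ ∈ S, ∑ x, p x * (ei (c x) γ * (if ∑ y, p y * ei (c y) γ ≤ τ / B then 1 else 0)) := by
        rw [Finset.sum_comm]
        refine Finset.sum_congr rfl fun x _ => ?_
        rw [Finset.sum_eq_single_of_mem (c x) (hS x)]
        · rw [ei_self, one_mul]
        · intro γ _ hγ
          rw [ei_of_ne (Ne.symm hγ), zero_mul, mul_zero]
    _ ≤ ∑ γ ∈ S, τ / B := by
        refine Finset.sum_le_sum fun γ _ => ?_
        split_ifs with h
        · simpa only [mul_one] using h
        · simp only [mul_zero, Finset.sum_const_zero]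
          positivity
    _ = S.card * (τ / B) := by rw [Finset.sum_const, nsmul_eq_mul]
    _ ≤ B * (τ / B) := by
        refine mul_le_mul_of_nonneg_right ?_ (by positivity)
        exact_mod_cast hB
    _ = τ := by field_simp

section final
variable {r : ℕ} {Ω : Fin r → Type} [∀ i, Fintype (Ω i)] (w : ∀ i, Ω i → ℝ)
  {K₁ K₂ : Type} [Fintype K₁] [Fintype K₂] (G : CGraph Ω K₁ K₂)

theorem card_cols (b₁ b₂ : ℕ) (hb₂ : 1 ≤ b₂) (hG : G.Bounded b₁ b₂) {m : ℕ} (φ : PMap Ω m)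
    (i : Fin r) : (univ.image ((regz Ω G φ).vCol i)).card ≤ b₁ * (b₂ ^ m) ^ r := by
  let T : Finset (K₁ × (Fin r → Fin m → Option K₂)) :=
    G.C1 i ×ˢ Fintype.piFinset fun j => Fintype.piFinset fun _ : Fin m =>
      if j = i then {none} else (G.C2 i j).image some
  have hsub : univ.image ((regz Ω G φ).vCol i) ⊆ T := by
    intro c hc
    obtain ⟨x, -, rfl⟩ := Finset.mem_image.1 hc
    simp only [T, Finset.mem_product, Fintype.mem_piFinset, regz]
    refine ⟨G.vMem i x, fun j b => ?_⟩
    by_cases hj : j = i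
    · simp [hj]
    · simp only [hj, if_false]
      exact Finset.mem_image_of_mem _ (G.eMem _ _ _ _)
  refine (Finset.card_le_card hsub).trans ?_
  simp only [T, Finset.card_product, Fintype.card_piFinset, Finset.prod_const, Finset.card_univ,
    Fintype.card_fin]
  refine Nat.mul_le_mul (hG.1 i) ?_
  have h1 : ∀ j ∈ (univ : Finset (Fin r)),
      (if j = i then {none} else (G.C2 i j).image some : Finset (Option K₂)).card ^ m ≤ b₂ ^ m := by
    intro j _
    refine Nat.pow_le_pow_left ?_ m
    split_ifs with hj
    · simpa using hb₂
    · exact (Finset.card_image_le).trans (hG.2 i j (Ne.symm hj))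
  refine (Finset.prod_le_prod' h1).trans (le_of_eq ?_)
  simp

/-- average refined deviation on one frame class -/
noncomputable def etaN {m : ℕ} (φ : PMap Ω m) (N : ℕ) (i j : Fin r) (c₂ : K₂)
    (γ : (K₁ × (Fin r → Fin m → Option K₂)) × (K₁ × (Fin r → Fin m → Option K₂))) : ℝ :=
  EPhi Ω w N (fun ψ => ce (mu w i j) (fr G φ i j) (dev w G φ ψ i j c₂) γ)

theorem dev_nonneg {m n : ℕ} (φ : PMap Ω m) (ψ : PMap Ω n) (i j : Fin r) (c₂ : K₂)
    (z : Ω i × Ω j) : 0 ≤ dev w G φ ψ i j c₂ z := sq_nonneg _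

theorem etaN_nonneg (hw : ∀ i x, 0 ≤ w i x) {m : ℕ} (φ : PMap Ω m) (N : ℕ) (i j : Fin r) (c₂ : K₂)
    (γ : (K₁ × (Fin r → Fin m → Option K₂)) × (K₁ × (Fin r → Fin m → Option K₂))) :
    0 ≤ etaN w G φ N i j c₂ γ :=
  EPhi_nonneg Ω w hw fun ψ => ce_nonneg _ (mu_nonneg w hw i j) _ _ (dev_nonneg w G φ ψ i j c₂) _

theorem ei_pair {A B : Type} (a c : A) (b d : B) : ei (a, b) (c, d) = ei a c * ei b d := by
  unfold ei
  by_cases h1 : a = c <;> by_cases h2 : b = d <;> simp [h1, h2]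

theorem etaN_mul (hw : ∀ i x, 0 ≤ w i x) {m : ℕ} (φ : PMap Ω m) (N : ℕ) (i j : Fin r) (c₂ : K₂)
    (ci cj : K₁ × (Fin r → Fin m → Option K₂)) :
    EPhi Ω w N (fun ψ => ∑ z, mu w i j z * (ei (fr G φ i j z) (ci, cj) * dev w G φ ψ i j c₂ z)) =
      etaN w G φ N i j c₂ (ci, cj) * ((∑ x, w i x * ei ((regz Ω G φ).vCol i x) ci) *
      (∑ y, w j y * ei ((regz Ω G φ).vCol j y) cj)) := by
  unfold etaN
  rw [mul_comm, ← EPhi_smul]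
  refine congrArg (EPhi Ω w N) (funext fun ψ => ?_)
  rw [← ce_tower (mu w i j) (mu_nonneg w hw i j) (fr G φ i j)
    (fun z => ei (fr G φ i j z) (ci, cj)) _ (fun z z' h => by rw [h])]
  rw [Finset.sum_mul_sum, Finset.sum_mul, Fintype.sum_prod_type]
  refine Finset.sum_congr rfl fun x _ => ?_
  rw [Finset.sum_mul]
  refine Finset.sum_congr rfl fun y _ => ?_
  have h1 : ei (fr G φ i j (x, y)) (ci, cj) =
      ei ((regz Ω G φ).vCol i x) ci * ei ((regz Ω G φ).vCol j y) cj := ei_pair _ _ _ _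
  by_cases h : fr G φ i j (x, y) = (ci, cj)
  · rw [h1, h]
    simp only [mu]
    ring
  · have h0 := ei_of_ne h
    rw [h0]
    rw [h0] at h1
    calc _ = 0 := by ring
      _ = w i x * w j y * (ei ((regz Ω G φ).vCol i x) ci * ei ((regz Ω G φ).vCol j y) cj) *
        ce (mu w i j) (fr G φ i j) (dev w G φ ψ i j c₂) (ci, cj) := by rw [← h1]; ring
      _ = _ := by ring

theorem etaN_avg (hw : ∀ i x, 0 ≤ w i x) {m : ℕ} (φ : PMap Ω m) (N : ℕ) (i j : Fin r) (c₂ : K₂) :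
    ∑ z, mu w i j z * etaN w G φ N i j c₂ (fr G φ i j z) =
      EPhi Ω w N (fun ψ => ∑ z, mu w i j z * dev w G φ ψ i j c₂ z) := by
  unfold etaN
  simp only [← EPhi_smul]
  rw [← EPhi_sum]
  refine congrArg (EPhi Ω w N) (funext fun ψ => ?_)
  have := ce_tower (mu w i j) (mu_nonneg w hw i j) (fr G φ i j) (fun _ => 1)
    (dev w G φ ψ i j c₂) (fun _ _ _ => rfl)
  simpa only [one_mul] using this

theorem mu_sum (hs : ∀ i, ∑ x, w i x = 1) (i j : Fin r) : ∑ z, mu w i j z = 1 := by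
  rw [Fintype.sum_prod_type]
  simp only [mu, ← Finset.mul_sum, hs, mul_one]

/-- good total colors -/
def GoodN {m : ℕ} (φ : PMap Ω m) (N B b₂ : ℕ) (τ θ : ℝ) (i j : Fin r) (c₂ : K₂)
    (ci cj : K₁ × (Fin r → Fin m → Option K₂)) : Prop :=
  ¬ (∑ x, w i x * ei ((regz Ω G φ).vCol i x) ci ≤ τ / B) ∧
  ¬ (∑ y, w j y * ei ((regz Ω G φ).vCol j y) cj ≤ τ / B) ∧
  ¬ (ce (mu w i j) (fr G φ i j) (ind G i j c₂) (ci, cj) ≤ τ / b₂) ∧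
  ¬ (θ < etaN w G φ N i j c₂ (ci, cj))

theorem avg_bound (hw : ∀ i x, 0 ≤ w i x) (hs : ∀ i, ∑ x, w i x = 1)
    (b₁ b₂ : ℕ) (hb₁ : 1 ≤ b₁) (hb₂ : 1 ≤ b₂) (hG : G.Bounded b₁ b₂)
    {m : ℕ} (φ : PMap Ω m) (N : ℕ) (δ0 τ θ : ℝ) (hδ0 : 0 ≤ δ0) (hτ : 0 < τ) (hθ : 0 < θ)
    {i j : Fin r} (hij : i < j) :
    EdgeDeltaAvg Ω w (regz Ω G φ) (del (GoodN w G φ N (b₁ * (b₂ ^ m) ^ r) b₂ τ θ) δ0) i j ≤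
      δ0 + 3 * τ + (1 / θ) * ∑ c₂ ∈ G.C2 i j,
        EPhi Ω w N (fun ψ => ∑ z, mu w i j z * dev w G φ ψ i j c₂ z) := by
  set B := b₁ * (b₂ ^ m) ^ r with hB
  have hB1 : 1 ≤ B := Nat.mul_pos hb₁ (by positivity)
  have hμ := mu_nonneg w hw i j
  have hμs := mu_sum w hs i j
  have hb2 : (0 : ℝ) < b₂ := by exact_mod_cast hb₂
  let D := fun z : Ω i × Ω j => G.eCol i j z.1 z.2
  let I1 : Ω i → ℝ := fun x =>
    if ∑ x', w i x' * ei ((regz Ω G φ).vCol i x') ((regz Ω G φ).vCol i x) ≤ τ / B then 1 else 0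
  let I2 : Ω j → ℝ := fun y =>
    if ∑ x', w j x' * ei ((regz Ω G φ).vCol j x') ((regz Ω G φ).vCol j y) ≤ τ / B then 1 else 0
  let I3 : K₂ → Ω i × Ω j → ℝ := fun c z =>
    if ce (mu w i j) (fr G φ i j) (ind G i j c) (fr G φ i j z) ≤ τ / b₂ then 1 else 0
  let I4 : K₂ → Ω i × Ω j → ℝ := fun c z => etaN w G φ N i j c (fr G φ i j z)
  have hI1 : ∀ x, 0 ≤ I1 x := fun x => by simp only [I1]; split_ifs <;> norm_num
  have hI2 : ∀ x, 0 ≤ I2 x := fun x => by simp only [I2]; split_ifs <;> norm_num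
  have hI3 : ∀ c x, 0 ≤ I3 c x := fun c x => by simp only [I3]; split_ifs <;> norm_num
  have hI4 : ∀ c z, 0 ≤ I4 c z := fun c z => etaN_nonneg w G hw φ N i j c _
  have pt : ∀ z : Ω i × Ω j, del (GoodN w G φ N B b₂ τ θ) δ0 i j (D z)
      ((regz Ω G φ).vCol i z.1) ((regz Ω G φ).vCol j z.2) ≤
      δ0 + I1 z.1 + I2 z.2 + I3 (D z) z + (1 / θ) * I4 (D z) z := by
    intro z
    have a1 := hI1 z.1
    have a2 := hI2 z.2
    have a3 := hI3 (D z) z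
    have a4 := hI4 (D z) z
    have a5 : 0 ≤ (1 / θ) * I4 (D z) z := by positivity
    simp only [del, hij, if_true]
    split_ifs with hg
    · linarith
    · simp only [GoodN, not_and_or, not_not] at hg
      rcases hg with hg | hg | hg | hg
      · have : I1 z.1 = 1 := if_pos hg
        linarith
      · have : I2 z.2 = 1 := if_pos hg
        linarith
      · have : I3 (D z) z = 1 := if_pos hg
        linarith
      · have h1 : θ < I4 (D z) z := hg
        have : 1 ≤ (1 / θ) * I4 (D z) z := by
          rw [one_div, inv_mul_eq_div, le_div_iff₀ hθ]; linarith
        linarith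
  have s1 : ∑ z : Ω i × Ω j, mu w i j z * I1 z.1 ≤ τ := by
    have : ∑ z : Ω i × Ω j, mu w i j z * I1 z.1 = ∑ x, w i x * I1 x := by
      rw [Fintype.sum_prod_type]
      refine Finset.sum_congr rfl fun x _ => ?_
      simp only [mu]
      rw [← Finset.sum_mul, ← Finset.mul_sum, hs, mul_one]
    rw [this]
    exact rare (w i) (hw i) ((regz Ω G φ).vCol i) _ (fun x => Finset.mem_image_of_mem _ (mem_univ x))
      B (card_cols G b₁ b₂ hb₂ hG φ i) hB1 τ hτ.le
  have s2 : ∑ z : Ω i × Ω j, mu w i j z * I2 z.2 ≤ τ := by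
    have : ∑ z : Ω i × Ω j, mu w i j z * I2 z.2 = ∑ y, w j y * I2 y := by
      rw [Fintype.sum_prod_type, Finset.sum_comm]
      refine Finset.sum_congr rfl fun y _ => ?_
      simp only [mu, mul_assoc]
      rw [← Finset.sum_mul, hs, one_mul]
    rw [this]
    exact rare (w j) (hw j) ((regz Ω G φ).vCol j) _ (fun x => Finset.mem_image_of_mem _ (mem_univ x))
      B (card_cols G b₁ b₂ hb₂ hG φ j) hB1 τ hτ.le
  have s3 : ∑ z : Ω i × Ω j, mu w i j z * I3 (D z) z ≤ τ := by
    calc ∑ z : Ω i × Ω j, mu w i j z * I3 (D z) z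
        = ∑ c ∈ G.C2 i j, ∑ z, mu w i j z * (I3 c z * ind G i j c z) := by
          rw [Finset.sum_comm]
          refine Finset.sum_congr rfl fun z _ => ?_
          rw [Finset.sum_eq_single_of_mem (D z) (G.eMem _ _ _ _)]
          · simp only [ind, D, if_true, mul_one]
          · intro c _ hc
            have : ind G i j c z = 0 := if_neg (Ne.symm hc)
            rw [this, mul_zero, mul_zero]
      _ ≤ ∑ c ∈ G.C2 i j, τ / b₂ := by
          refine Finset.sum_le_sum fun c _ => ?_
          rw [← ce_tower (mu w i j) hμ (fr G φ i j) (I3 c) (ind G i j c)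
            (fun z z' h => by simp only [I3, h])]
          calc _ ≤ ∑ z, mu w i j z * (τ / b₂) := by
                refine Finset.sum_le_sum fun z _ => mul_le_mul_of_nonneg_left ?_ (hμ z)
                simp only [I3]
                split_ifs with h
                · linarith
                · rw [zero_mul]; positivity
            _ = τ / b₂ := by rw [← Finset.sum_mul, hμs, one_mul]
      _ = (G.C2 i j).card * (τ / b₂) := by rw [Finset.sum_const, nsmul_eq_mul]
      _ ≤ b₂ * (τ / b₂) := by
          refine mul_le_mul_of_nonneg_right ?_ (by positivity)
          exact_mod_cast hG.2 i j hij.ne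
      _ = τ := by field_simp
  have s4 : ∑ z : Ω i × Ω j, mu w i j z * I4 (D z) z ≤ ∑ c₂ ∈ G.C2 i j,
        EPhi Ω w N (fun ψ => ∑ z, mu w i j z * dev w G φ ψ i j c₂ z) := by
    simp only [← etaN_avg w G hw]
    rw [Finset.sum_comm]
    refine Finset.sum_le_sum fun z _ => ?_
    exact Finset.single_le_sum (f := fun c => mu w i j z * I4 c z)
      (fun c _ => mul_nonneg (hμ z) (hI4 c z)) (G.eMem i j z.1 z.2)
  calc EdgeDeltaAvg Ω w (regz Ω G φ) (del (GoodN w G φ N B b₂ τ θ) δ0) i j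
      = ∑ z : Ω i × Ω j, mu w i j z * del (GoodN w G φ N B b₂ τ θ) δ0 i j (D z)
          ((regz Ω G φ).vCol i z.1) ((regz Ω G φ).vCol j z.2) := by
        rw [EdgeDeltaAvg, Fintype.sum_prod_type]; rfl
    _ ≤ ∑ z : Ω i × Ω j, mu w i j z *
        (δ0 + I1 z.1 + I2 z.2 + I3 (D z) z + (1 / θ) * I4 (D z) z) :=
        Finset.sum_le_sum fun z _ => mul_le_mul_of_nonneg_left (pt z) (hμ z)
    _ = δ0 * ∑ z, mu w i j z + ∑ z, mu w i j z * I1 z.1 + ∑ z, mu w i j z * I2 z.2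
        + ∑ z, mu w i j z * I3 (D z) z + (1 / θ) * ∑ z, mu w i j z * I4 (D z) z := by
        rw [Finset.mul_sum, Finset.mul_sum, ← Finset.sum_add_distrib, ← Finset.sum_add_distrib,
          ← Finset.sum_add_distrib, ← Finset.sum_add_distrib]
        exact Finset.sum_congr rfl fun z _ => by ring
    _ ≤ _ := by
        rw [hμs]
        have := mul_le_mul_of_nonneg_left s4 (one_div_pos.2 hθ).le
        linarith

end final

/-! ## Energy increment and conclusion -/

section energy
variable {r : ℕ} {Ω : Fin r → Type} [∀ i, Fintype (Ω i)] (w : ∀ i, Ω i → ℝ)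
  {K₁ K₂ : Type} [Fintype K₁] [Fintype K₂] (G : CGraph Ω K₁ K₂)

/-- energy of one edge color -/
noncomputable def En {m : ℕ} (φ : PMap Ω m) (i j : Fin r) (c₂ : K₂) : ℝ :=
  ∑ z, mu w i j z * ce (mu w i j) (fr G φ i j) (ind G i j c₂) (fr G φ i j z) ^ 2

/-- total energy -/
noncomputable def Etot {m : ℕ} (φ : PMap Ω m) : ℝ :=
  ∑ i, ∑ j, if i < j then ∑ c₂ ∈ G.C2 i j, En w G φ i j c₂ else 0

theorem En_bd (hw : ∀ i x, 0 ≤ w i x) (hs : ∀ i, ∑ x, w i x = 1) {m : ℕ} (φ : PMap Ω m)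
    (i j : Fin r) (c₂ : K₂) : 0 ≤ En w G φ i j c₂ ∧ En w G φ i j c₂ ≤ 1 := by
  have hμ := mu_nonneg w hw i j
  refine ⟨Finset.sum_nonneg fun z _ => mul_nonneg (hμ z) (sq_nonneg _), ?_⟩
  rw [← mu_sum w hs i j]
  refine Finset.sum_le_sum fun z _ => mul_le_of_le_one_right (hμ z) ?_
  exact pow_le_one₀ (ce_nonneg _ hμ _ _ (fun z => (ind_bd G i j c₂ z).1) _)
    (ce_le_one _ hμ _ _ (fun z => (ind_bd G i j c₂ z).2) _)

theorem Etot_bd (hw : ∀ i x, 0 ≤ w i x) (hs : ∀ i, ∑ x, w i x = 1) (b₁ b₂ : ℕ)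
    (hG : G.Bounded b₁ b₂) {m : ℕ} (φ : PMap Ω m) :
    0 ≤ Etot w G φ ∧ Etot w G φ ≤ r * (r * b₂) := by
  constructor
  · refine Finset.sum_nonneg fun i _ => Finset.sum_nonneg fun j _ => ?_
    split_ifs
    · exact Finset.sum_nonneg fun c _ => (En_bd w G hw hs φ i j c).1
    · exact le_rfl
  · calc Etot w G φ ≤ ∑ _i : Fin r, ∑ _j : Fin r, (b₂ : ℝ) := by
          refine Finset.sum_le_sum fun i _ => Finset.sum_le_sum fun j _ => ?_
          split_ifs with hij
          · calc _ ≤ ∑ _c ∈ G.C2 i j, (1 : ℝ) :=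
                  Finset.sum_le_sum fun c _ => (En_bd w G hw hs φ i j c).2
              _ = (G.C2 i j).card := by simp
              _ ≤ b₂ := by exact_mod_cast hG.2 i j hij.ne
          · positivity
      _ = r * (r * b₂) := by simp

theorem dev_energy (hw : ∀ i x, 0 ≤ w i x) {m n : ℕ} (φ : PMap Ω m) (ψ : PMap Ω n)
    (i j : Fin r) (c₂ : K₂) :
    ∑ z, mu w i j z * dev w G φ ψ i j c₂ z = En w G (papp φ ψ) i j c₂ - En w G φ i j c₂ := by
  have := ce_pyth (mu w i j) (mu_nonneg w hw i j) (fr G φ i j) (fr G (papp φ ψ) i j)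
    (fun z z' h => ((fr_papp G φ ψ i j z z').1 h).1) (fun _ => 1) (ind G i j c₂) (fun _ _ _ => rfl)
  simp only [one_mul] at this
  unfold En dev
  linarith

theorem Etot_diff (hw : ∀ i x, 0 ≤ w i x) (hs : ∀ i, ∑ x, w i x = 1) {m : ℕ} (φ : PMap Ω m)
    (N : ℕ) :
    EPhi Ω w N (fun ψ => Etot w G (papp φ ψ)) - Etot w G φ =
      ∑ i, ∑ j, if i < j then ∑ c₂ ∈ G.C2 i j,
        EPhi Ω w N (fun ψ => ∑ z, mu w i j z * dev w G φ ψ i j c₂ z) else 0 := by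
  have h1 : EPhi Ω w N (fun ψ => Etot w G (papp φ ψ)) =
      Etot w G φ + EPhi Ω w N (fun ψ => ∑ i, ∑ j, if i < j then ∑ c₂ ∈ G.C2 i j,
        ∑ z, mu w i j z * dev w G φ ψ i j c₂ z else 0) := by
    conv_rhs => rw [← EPhi_const Ω w hs (h := N) (Etot w G φ)]
    rw [← EPhi_add]
    refine congrArg (EPhi Ω w N) (funext fun ψ => ?_)
    unfold Etot
    simp only [dev_energy w G hw]
    rw [← Finset.sum_add_distrib]
    refine Finset.sum_congr rfl fun i _ => ?_
    rw [← Finset.sum_add_distrib]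
    refine Finset.sum_congr rfl fun j _ => ?_
    split_ifs
    · rw [← Finset.sum_add_distrib]
      exact Finset.sum_congr rfl fun c _ => by ring
    · ring
  rw [h1, add_sub_cancel_left, EPhi_sum]
  refine Finset.sum_congr rfl fun i _ => ?_
  rw [EPhi_sum]
  refine Finset.sum_congr rfl fun j _ => ?_
  split_ifs
  · rw [EPhi_sum]
  · exact EPhi_const Ω w hs 0

theorem reg_le [∀ i, Nonempty (Ω i)] (hr : 2 ≤ r) (hw : ∀ i x, 0 ≤ w i x)
    (hs : ∀ i, ∑ x, w i x = 1) (h : ℕ)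
    (b₁ b₂ : ℕ) (hb₁ : 1 ≤ b₁) (hb₂ : 1 ≤ b₂) (hG : G.Bounded b₁ b₂)
    {m : ℕ} (φ : PMap Ω m) (N : ℕ) (δ0 τ κ : ℝ) (hδ0 : 0 ≤ δ0) (hτ : 0 < τ) (hτ1 : τ ≤ 1)
    (hκ0 : 0 < κ)
    (hκ : ((r * (r * (h * h)) : ℕ) : ℝ) * κ ≤ δ0 * (τ / b₂) ^ (r * (r * (h * h))))
    (hN : 1 ≤ N * (τ / ((b₁ * (b₂ ^ m) ^ r : ℕ) : ℝ)) ^ 2) :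
    reg Ω w (regz Ω G φ) h ≤ b₂ * (δ0 + 3 * τ + (2 / κ ^ 8) *
      (EPhi Ω w N (fun ψ => Etot w G (papp φ ψ)) - Etot w G φ)) := by
  set B := b₁ * (b₂ ^ m) ^ r with hB
  have hB1 : 1 ≤ B := Nat.mul_pos hb₁ (by positivity)
  have hB0 : (0 : ℝ) < B := by exact_mod_cast hB1
  have hb2 : (1 : ℝ) ≤ b₂ := by exact_mod_cast hb₂
  have hb20 : (0 : ℝ) < b₂ := by linarith
  have hμ := fun i j => mu_nonneg w hw i j
  let θ : ℝ := κ ^ 8 / 2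
  have hθ : 0 < θ := by positivity
  have hcard : ∀ i j, 1 ≤ (G.C2 i j).card := by
    intro i j
    obtain ⟨x⟩ := (inferInstance : Nonempty (Ω i))
    obtain ⟨y⟩ := (inferInstance : Nonempty (Ω j))
    exact Finset.card_pos.2 ⟨_, G.eMem i j x y⟩
  have hbdd : BddBelow {ε : ℝ | IsRegularG Ω w (regz Ω G φ) h ε} := by
    refine ⟨0, fun ε hε => ?_⟩
    obtain ⟨δ, hδ, -, h3⟩ := hε
    let i : Fin r := ⟨0, by omega⟩
    let j : Fin r := ⟨1, by omega⟩
    have hij : i ≠ j := by simp [i, j]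
    have h4 := h3 i j hij
    have h5 : 0 ≤ EdgeDeltaAvg Ω w (regz Ω G φ) δ i j :=
      Finset.sum_nonneg fun x _ => Finset.sum_nonneg fun y _ =>
        mul_nonneg (mul_nonneg (hw _ _) (hw _ _)) (hδ _ _ _ _ _)
    have h6 : (0 : ℝ) < ((regz Ω G φ).C2 i j).card := by exact_mod_cast hcard i j
    have h7 := h5.trans h4
    by_contra hneg
    push Not at hneg
    exact absurd h7 (not_le.2 (div_neg_of_neg_of_pos hneg h6))
  refine csInf_le hbdd ?_
  refine ⟨del (GoodN w G φ N B b₂ τ θ) δ0, ?_, ?_, ?_⟩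
  · intro i j c₂ ci cj
    unfold del
    split_ifs <;> first | exact hδ0 | norm_num
  · refine isErrorFun_del Ω w (regz Ω G φ) hw hs h _ δ0 (τ / b₂) κ hδ0 (by positivity)
      ((div_le_one hb20).2 (hτ1.trans hb2)) hκ0.le hκ ?_ ?_
    · intro i j c₂ ci cj _ hg
      rw [dE_eq_ce]
      exact (not_le.1 hg.2.2.1).le
    · intro i j c₂ ci cj hij hg u v hu hv
      obtain ⟨g1, g2, -, g4⟩ := hg
      rw [not_le] at g1 g2
      rw [not_lt] at g4
      set p := (∑ x, w i x * ei ((regz Ω G φ).vCol i x) ci) *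
        (∑ y, w j y * ei ((regz Ω G φ).vCol j y) cj) with hp
      have hq : 0 < τ / (B : ℝ) := by positivity
      have hp2 : (τ / (B : ℝ)) ^ 2 ≤ p := by
        rw [sq]; exact mul_le_mul g1.le g2.le hq.le (hq.le.trans g1.le)
      have hp0 : 0 ≤ p := (sq_nonneg _).trans hp2
      have hcb := cut_bound w G hw hs φ hij.ne c₂ ci cj N p θ hp
        (hN.trans (mul_le_mul_of_nonneg_left hp2 (Nat.cast_nonneg N)))
        (by rw [etaN_mul w G hw]; exact mul_le_mul_of_nonneg_right g4 hp0) u v hu hv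
      have e8 : 2 * θ * p ^ 8 = (κ * p) ^ 8 := by simp only [θ]; ring
      rw [e8] at hcb
      rw [dE_eq_ce]
      refine (pow_le_pow_iff_left₀ (abs_nonneg _) (mul_nonneg hκ0.le hp0)
        (n := 8) (by norm_num)).1 ?_
      rw [Even.pow_abs (by decide)]
      exact hcb
  · intro i j hij
    have hc1 : (1 : ℝ) ≤ ((regz Ω G φ).C2 i j).card := by exact_mod_cast hcard i j
    have hc2 : (((regz Ω G φ).C2 i j).card : ℝ) ≤ b₂ := by exact_mod_cast hG.2 i j hij
    have hX0 : ∀ i j, 0 ≤ ∑ c₂ ∈ G.C2 i j,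
        EPhi Ω w N (fun ψ => ∑ z, mu w i j z * dev w G φ ψ i j c₂ z) := fun i j =>
      Finset.sum_nonneg fun c _ => EPhi_nonneg Ω w hw fun ψ => Finset.sum_nonneg fun z _ =>
        mul_nonneg (hμ i j z) (dev_nonneg w G φ ψ i j c z)
    have hif : ∀ i j : Fin r, 0 ≤ (if i < j then ∑ c₂ ∈ G.C2 i j,
        EPhi Ω w N (fun ψ => ∑ z, mu w i j z * dev w G φ ψ i j c₂ z) else 0) := by
      intro i j
      split_ifs
      · exact hX0 i j
      · exact le_rfl
    rw [Etot_diff w G hw hs]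
    set Y := ∑ i, ∑ j, if i < j then ∑ c₂ ∈ G.C2 i j,
        EPhi Ω w N (fun ψ => ∑ z, mu w i j z * dev w G φ ψ i j c₂ z) else 0 with hY
    have hY0 : 0 ≤ Y := Finset.sum_nonneg fun i _ => Finset.sum_nonneg fun j _ => hif i j
    have hZ : 0 ≤ δ0 + 3 * τ + (2 / κ ^ 8) * Y := by positivity
    have hle : δ0 + 3 * τ + (2 / κ ^ 8) * Y ≤
        b₂ * (δ0 + 3 * τ + (2 / κ ^ 8) * Y) / ((regz Ω G φ).C2 i j).card := by
      rw [le_div_iff₀ (by linarith), mul_comm]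
      exact mul_le_mul_of_nonneg_right hc2 hZ
    refine le_trans ?_ hle
    rcases lt_or_gt_of_ne hij with hlt | hgt
    · refine (avg_bound w G hw hs b₁ b₂ hb₁ hb₂ hG φ N δ0 τ θ hδ0 hτ hθ hlt).trans ?_
      have e1 : 1 / θ = 2 / κ ^ 8 := by simp only [θ]; field_simp
      rw [e1]
      refine add_le_add le_rfl (mul_le_mul_of_nonneg_left ?_ (by positivity))
      have h1 := Finset.single_le_sum (f := fun j => if i < j then ∑ c₂ ∈ G.C2 i j,
        EPhi Ω w N (fun ψ => ∑ z, mu w i j z * dev w G φ ψ i j c₂ z) else 0)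
        (fun j _ => hif i j) (Finset.mem_univ j)
      have h2 := Finset.single_le_sum (f := fun i => ∑ j, if i < j then ∑ c₂ ∈ G.C2 i j,
        EPhi Ω w N (fun ψ => ∑ z, mu w i j z * dev w G φ ψ i j c₂ z) else 0)
        (fun i _ => Finset.sum_nonneg fun j _ => hif i j) (Finset.mem_univ i)
      simp only [hlt, if_true] at h1
      exact h1.trans h2
    · have : EdgeDeltaAvg Ω w (regz Ω G φ) (del (GoodN w G φ N B b₂ τ θ) δ0) i j = 0 := by
        refine Finset.sum_eq_zero fun x _ => Finset.sum_eq_zero fun y _ => ?_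
        simp only [del, not_lt.2 hgt.le, if_false, mul_zero]
      rw [this]
      exact hZ

end energy

/-- sample sizes -/
noncomputable def mseq (r b₁ b₂ : ℕ) (τ : ℝ) : ℕ → ℕ
  | 0 => 0
  | n + 1 => mseq r b₁ b₂ τ n +
      (⌈(((b₁ * (b₂ ^ (mseq r b₁ b₂ τ n)) ^ r : ℕ) : ℝ) / τ) ^ 2⌉₊ + 1)

/-- Main Theorem. For any `r ≥ 2`, `h, b₁, b₂ ≥ 1` and `ε > 0`
there are an increasing function `m : ℕ → ℕ` and a positive integer `nt`
(independent of `Ω`) such that for every `(b₁,b₂)`-colored `𝔯`-partite graph `G`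
on `Ω`: `E_n E_{φ∈Φ(m n)} [reg_h(G/φ)] ≤ ε`, where `n` is uniform on
`{0,…,nt−1}` and `φ ∈ Φ(m n)` is a random partitionwise map. -/
theorem main_theorem (r : ℕ) (hr : 2 ≤ r) (h b₁ b₂ : ℕ) (hh : 1 ≤ h)
    (hb₁ : 1 ≤ b₁) (hb₂ : 1 ≤ b₂) (ε : ℝ) (hε : 0 < ε) :
    ∃ (m : ℕ → ℕ) (nt : ℕ), StrictMono m ∧ 1 ≤ nt ∧
      ∀ (Ω : Fin r → Type) [∀ i, Fintype (Ω i)] [∀ i, Nonempty (Ω i)]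
        (w : ∀ i, Ω i → ℝ), (∀ i x, 0 ≤ w i x) → (∀ i, ∑ x : Ω i, w i x = 1) →
        ∀ (K₁ K₂ : Type) [Fintype K₁] [Fintype K₂] (G : CGraph Ω K₁ K₂),
          G.Bounded b₁ b₂ →
          (1 / nt : ℝ) * ∑ n ∈ Finset.range nt,
              EPhi Ω w (m n) (fun φ => reg Ω w (regz Ω G φ) h) ≤ ε := by
  have hb2 : (1 : ℝ) ≤ b₂ := by exact_mod_cast hb₂
  have hb20 : (0 : ℝ) < b₂ := by linarith
  set n0 := r * (r * (h * h)) with hn0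
  set δ0 : ℝ := ε / (4 * b₂) with hδ
  have hδ0 : 0 < δ0 := by positivity
  set τ : ℝ := min 1 (ε / (12 * b₂)) with hτd
  have hτ : 0 < τ := lt_min one_pos (by positivity)
  have hτ1 : τ ≤ 1 := min_le_left _ _
  have hτ2 : τ ≤ ε / (12 * b₂) := min_le_right _ _
  set κ : ℝ := δ0 * (τ / b₂) ^ n0 / (n0 + 1) with hκd
  have hκ0 : 0 < κ := by positivity
  have hκ : (n0 : ℝ) * κ ≤ δ0 * (τ / b₂) ^ n0 := by
    rw [hκd, ← mul_div_assoc, div_le_iff₀ (by positivity), mul_comm]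
    exact mul_le_mul_of_nonneg_left (by linarith) (by positivity)
  set R : ℝ := b₂ * (2 / κ ^ 8) * (r * (r * b₂)) with hR
  have hR0 : 0 ≤ R := by positivity
  set nt : ℕ := ⌈2 * R / ε⌉₊ + 1 with hnt
  have hntR : 2 * R / ε ≤ nt := by
    rw [hnt]; push_cast
    exact (Nat.le_ceil _).trans (by linarith)
  have hnt0 : (0 : ℝ) < nt := by rw [hnt]; positivity
  set m := mseq r b₁ b₂ τ with hm
  refine ⟨m, nt, ?_, by omega, ?_⟩
  · refine strictMono_nat_of_lt_succ fun n => ?_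
    simp only [hm, mseq]
    omega
  intro Ω _ _ w hw hs K₁ K₂ _ _ G hG
  let T : ℕ → ℝ := fun n => EPhi Ω w (m n) (fun φ => Etot w G φ)
  have step : ∀ n, EPhi Ω w (m n) (fun φ => reg Ω w (regz Ω G φ) h) ≤
      b₂ * (δ0 + 3 * τ) + b₂ * (2 / κ ^ 8) * (T (n + 1) - T n) := by
    intro n
    set B := b₁ * (b₂ ^ (m n)) ^ r with hB
    have hB1 : 1 ≤ B := Nat.mul_pos hb₁ (by positivity)
    have hB0 : (0 : ℝ) < B := by exact_mod_cast hB1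
    set N := ⌈((B : ℝ) / τ) ^ 2⌉₊ + 1 with hNd
    have hN : 1 ≤ (N : ℝ) * (τ / (B : ℝ)) ^ 2 := by
      have h1 : ((B : ℝ) / τ) ^ 2 ≤ N := by
        rw [hNd]; push_cast
        exact (Nat.le_ceil _).trans (by linarith)
      calc (1 : ℝ) = ((B : ℝ) / τ) ^ 2 * (τ / (B : ℝ)) ^ 2 := by field_simp
        _ ≤ _ := mul_le_mul_of_nonneg_right h1 (sq_nonneg _)
    have hms : m (n + 1) = m n + N := rfl
    have hT : T (n + 1) = EPhi Ω w (m n) (fun φ => EPhi Ω w N (fun ψ => Etot w G (papp φ ψ))) := by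
      simp only [T]
      exact EPhi_papp Ω w (a := m n) (b := N) (fun φ => Etot w G φ)
    calc EPhi Ω w (m n) (fun φ => reg Ω w (regz Ω G φ) h)
        ≤ EPhi Ω w (m n) (fun φ => b₂ * (δ0 + 3 * τ) + (b₂ * (2 / κ ^ 8) *
            EPhi Ω w N (fun ψ => Etot w G (papp φ ψ)) + (-(b₂ * (2 / κ ^ 8))) * Etot w G φ)) := by
          refine EPhi_mono Ω w hw fun φ => ?_
          refine (reg_le w G hr hw hs h b₁ b₂ hb₁ hb₂ hG φ N δ0 τ κ hδ0.le hτ hτ1 hκ0 hκ hN).trans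
            (le_of_eq ?_)
          ring
      _ = _ := by
          rw [EPhi_add, EPhi_const Ω w hs, EPhi_add, EPhi_smul, EPhi_smul, ← hT]
          ring
  have htel : ∑ n ∈ Finset.range nt, (T (n + 1) - T n) = T nt - T 0 := Finset.sum_range_sub T nt
  have hT1 : T nt ≤ r * (r * b₂) := by
    rw [← EPhi_const Ω w hs (h := m nt) ((r : ℝ) * (r * b₂))]
    exact EPhi_mono Ω w hw fun φ => (Etot_bd w G hw hs b₁ b₂ hG φ).2
  have hT0 : 0 ≤ T 0 := EPhi_nonneg Ω w hw fun φ => (Etot_bd w G hw hs b₁ b₂ hG φ).1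
  have hsum : ∑ n ∈ Finset.range nt, EPhi Ω w (m n) (fun φ => reg Ω w (regz Ω G φ) h) ≤
      nt * (b₂ * (δ0 + 3 * τ)) + R := by
    refine (Finset.sum_le_sum fun n _ => step n).trans ?_
    rw [Finset.sum_add_distrib, Finset.sum_const, Finset.card_range, nsmul_eq_mul,
      ← Finset.mul_sum, htel, hR]
    exact add_le_add le_rfl (mul_le_mul_of_nonneg_left (by linarith) (by positivity))
  have hmain : b₂ * (δ0 + 3 * τ) ≤ ε / 2 := by
    calc b₂ * (δ0 + 3 * τ) ≤ b₂ * (δ0 + 3 * (ε / (12 * b₂))) :=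
          mul_le_mul_of_nonneg_left (by linarith) hb20.le
      _ = ε / 2 := by rw [hδ]; field_simp; norm_num
  have hRn : R ≤ nt * (ε / 2) := by
    rw [div_le_iff₀ hε] at hntR
    linarith
  rw [one_div, inv_mul_eq_div, div_le_iff₀ hnt0]
  refine hsum.trans ?_
  have := mul_le_mul_of_nonneg_left hmain hnt0.le
  linarith
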